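/- Fix integers n and k with 3 ≤ k ≤ n. For every integer i ≥ 0, the singular homology group H_i(M_{n,k}; ℤ) is torsion free. -/

import Mathlib

open CategoryTheory

/-- The singular chain complex of a topological space with `ℤ` coefficients. -/
noncomputable def singularChainComplex (X : TopCat) : ChainComplex (ModuleCat ℤ) ℕ :=
  (AlgebraicTopology.alternatingFaceMapComplex (ModuleCat ℤ)).obj
    (((SimplicialObject.whiskering _ _).obj (ModuleCat.free ℤ)).obj (TopCat.toSSet.obj X))

/-- The `i`-th singular homology of a topological space with `ℤ` coefficients. -/
noncomputable def singularHomology (X : TopCat) (i : ℕ) : ModuleCat ℤ :=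
  (singularChainComplex X).homology i

/-- The complement of the `k`-equal arrangement in `ℝ^{n+1}`. -/
def kEqualComplement (n k : ℕ) : Set (Fin (n + 1) → ℝ) :=
  {x | ∀ S : Finset (Fin (n + 1)), S.card = k → ¬ (∀ i ∈ S, ∀ j ∈ S, x i = x j)}


namespace KEq

/-! ### Formal chains on finite sequences of points -/

theorem lin_ext {α M : Type*} [AddCommGroup M] {f g : (α →₀ ℤ) →ₗ[ℤ] M}
    (h : ∀ a, f (Finsupp.single a 1) = g (Finsupp.single a 1)) : f = g := by
  refine Finsupp.lhom_ext' fun a => LinearMap.ext_ring ?_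
  simpa using h a

theorem lin_apply_mem {α M : Type*} [AddCommGroup M] (f : (α →₀ ℤ) →ₗ[ℤ] M) (N : Submodule ℤ M)
    {s : Set α} (h : ∀ a ∈ s, f (Finsupp.single a 1) ∈ N) {x : α →₀ ℤ}
    (hx : x ∈ Finsupp.supported ℤ ℤ s) : f x ∈ N := by
  rw [Finsupp.supported_eq_span_single] at hx
  induction hx using Submodule.span_induction with
  | mem x hx => obtain ⟨a, ha, rfl⟩ := hx; exact h a ha
  | zero => simp
  | add x y _ _ hx hy => rw [map_add]; exact N.add_mem hx hy
  | smul c x _ hx => rw [map_smul]; exact N.smul_mem c hx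

/-- Formal chains on finite sequences. -/
abbrev LC (K : Type) := (Σ n : ℕ, Fin n → K) →₀ ℤ

/-- The generator attached to a sequence. -/
noncomputable def pt {K : Type} {n : ℕ} (l : Fin n → K) : LC K := Finsupp.single ⟨n, l⟩ 1

/-- Linear extension of a function on sequences. -/
noncomputable def lift {K M : Type} [AddCommGroup M] (F : ∀ n, (Fin n → K) → M) : LC K →ₗ[ℤ] M :=
  Finsupp.linearCombination ℤ fun a => F a.1 a.2

@[simp] theorem lift_pt {K M : Type} [AddCommGroup M] (F : ∀ n, (Fin n → K) → M) {n : ℕ}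
    (l : Fin n → K) : lift F (pt l) = F n l := by
  simp [lift, pt]

theorem lc_ext {K M : Type} [AddCommGroup M] {f g : LC K →ₗ[ℤ] M}
    (h : ∀ n (l : Fin n → K), f (pt l) = g (pt l)) : f = g :=
  lin_ext fun a => h a.1 a.2

/-- Functoriality of formal chains. -/
noncomputable def lmap {K K' : Type} (f : K → K') : LC K →ₗ[ℤ] LC K' :=
  lift fun _ l => pt (f ∘ l)

@[simp] theorem lmap_pt {K K' : Type} (f : K → K') {n : ℕ} (l : Fin n → K) :
    lmap f (pt l) = pt (f ∘ l) := by simp [lmap]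

/-- The cone operator. -/
noncomputable def cone {K : Type} (v : K) : LC K →ₗ[ℤ] LC K :=
  lift fun n l => pt (Fin.cons v l : Fin (n + 1) → K)

@[simp] theorem cone_pt {K : Type} (v : K) {n : ℕ} (l : Fin n → K) :
    cone v (pt l) = pt (Fin.cons v l : Fin (n + 1) → K) := by simp [cone]

theorem comp_cons {K K' : Type} (f : K → K') (v : K) {n : ℕ} (l : Fin n → K) :
    f ∘ (Fin.cons v l : Fin (n + 1) → K) = Fin.cons (f v) (f ∘ l) := by
  funext i
  refine Fin.cases ?_ (fun i => ?_) i <;> simp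

theorem lmap_cone {K K' : Type} (f : K → K') (v : K) (c : LC K) :
    lmap f (cone v c) = cone (f v) (lmap f c) := by
  have : (lmap f).comp (cone v) = (cone (f v)).comp (lmap f) :=
    lc_ext fun n l => by simp [comp_cons]
  exact LinearMap.congr_fun this c

/-- Values of the boundary operator on sequences. -/
noncomputable def bdFun {K : Type} : ∀ n, (Fin n → K) → LC K
  | 0, _ => 0
  | n + 1, l => ∑ i : Fin (n + 1), (-1 : ℤ) ^ (i : ℕ) • pt (l ∘ i.succAbove)

/-- The (augmented) boundary operator on formal chains. -/
noncomputable def bd {K : Type} : LC K →ₗ[ℤ] LC K := lift bdFun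

theorem bd_pt_zero {K : Type} (l : Fin 0 → K) : bd (pt l) = 0 := by simp [bd, bdFun]

theorem bd_pt_succ {K : Type} {n : ℕ} (l : Fin (n + 1) → K) :
    bd (pt l) = ∑ i : Fin (n + 1), (-1 : ℤ) ^ (i : ℕ) • pt (l ∘ i.succAbove) := by simp [bd, bdFun]

theorem cons_comp_succAbove_succ {K : Type} (v : K) {n : ℕ} (l : Fin (n + 1) → K)
    (i : Fin (n + 1)) :
    (Fin.cons v l : Fin (n + 2) → K) ∘ i.succ.succAbove = Fin.cons v (l ∘ i.succAbove) := by
  funext j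
  refine Fin.cases ?_ (fun j => ?_) j <;> simp

theorem bd_cone {K : Type} (v : K) (c : LC K) : bd (cone v c) = c - cone v (bd c) := by
  have : (bd).comp (cone v) = LinearMap.id - (cone v).comp bd := by
    refine lc_ext fun n l => ?_
    simp only [LinearMap.comp_apply, cone_pt, LinearMap.sub_apply, LinearMap.id_apply]
    rw [bd_pt_succ, Fin.sum_univ_succ]
    have h0 : (Fin.cons v l : Fin (n + 1) → K) ∘ (0 : Fin (n + 1)).succAbove = l := by
      funext j; simp
    rw [h0]
    cases n with
    | zero => simp [bd_pt_zero]
    | succ n =>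
      rw [bd_pt_succ, map_sum]
      simp only [cons_comp_succAbove_succ, map_zsmul, cone_pt]
      simp [pow_succ, sub_eq_add_neg]
  exact LinearMap.congr_fun this c

theorem lmap_bd {K K' : Type} (f : K → K') (c : LC K) : lmap f (bd c) = bd (lmap f c) := by
  have : (lmap f).comp bd = bd.comp (lmap f) := by
    refine lc_ext fun n l => ?_
    cases n with
    | zero => simp [bd_pt_zero]
    | succ n =>
      simp only [LinearMap.comp_apply, lmap_pt, bd_pt_succ, map_sum, map_zsmul]
      rfl
  exact LinearMap.congr_fun this c

theorem bd_bd {K : Type} (c : LC K) : bd (bd c) = 0 := by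
  have : (bd (K := K)).comp bd = 0 := by
    refine lc_ext fun n => ?_
    induction n with
    | zero => intro l; simp [bd_pt_zero]
    | succ n ih =>
      intro l
      have hl : pt l = cone (l 0) (pt (Fin.tail l)) := by simp
      have := ih (Fin.tail l)
      simp only [LinearMap.comp_apply, LinearMap.zero_apply] at this ⊢
      rw [hl, bd_cone, map_sub, bd_cone, this]
      simp
  exact LinearMap.congr_fun this c

/-! ### Convex spaces -/

/-- The standard simplex with `n` vertices. -/
abbrev Dl (n : ℕ) := stdSimplex ℝ (Fin n)

/-- Convex combinations in a simplex. -/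
noncomputable def scomb {m n : ℕ} (t : Fin n → Dl m) (s : Dl n) : Dl m :=
  ⟨∑ i, s i • (t i : Fin m → ℝ), by
    refine (convex_stdSimplex ℝ (Fin m)).sum_mem ?_ ?_ ?_
    · intro i _; exact s.2.1 i
    · exact s.2.2
    · intro i _; exact (t i).2⟩

theorem scomb_apply {m n : ℕ} (t : Fin n → Dl m) (s : Dl n) (j : Fin m) :
    scomb t s j = ∑ i, s i * t i j := by
  change (∑ i, s i • (t i : Fin m → ℝ)) j = _
  simp [Finset.sum_apply]

/-- Spaces with continuous convex combinations. -/
class Cvx (K : Type) [TopologicalSpace K] where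
  comb : ∀ {n : ℕ}, (Fin n → K) → Dl n → K
  cont : ∀ {n : ℕ} (l : Fin n → K), Continuous (comb l)
  vert : ∀ {n : ℕ} (l : Fin n → K) (i : Fin n), comb l (stdSimplex.vertex i) = l i
  assoc : ∀ {m n : ℕ} (w : Fin m → K) (t : Fin n → Dl m) (s : Dl n),
    comb (fun i => comb w (t i)) s = comb w (scomb t s)

noncomputable instance (m : ℕ) : Cvx (Dl m) where
  comb := scomb
  cont l := by
    refine Continuous.subtype_mk ?_ _
    refine continuous_finsetSum _ fun i _ => ?_
    have h : Continuous fun s : Dl _ => s i := (continuous_apply i).comp continuous_subtype_val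
    exact h.smul continuous_const
  vert l i := by
    refine stdSimplex.ext (funext fun j => ?_)
    rw [scomb_apply, Finset.sum_eq_single i]
    · simp
    · intro b _ hb; simp [hb]
    · simp
  assoc w t s := by
    refine stdSimplex.ext (funext fun j => ?_)
    simp only [scomb_apply, Finset.mul_sum, Finset.sum_mul]
    rw [Finset.sum_comm]
    simp only [mul_assoc]

noncomputable instance : Cvx unitInterval where
  comb {n} l s := ⟨∑ i, s i * (l i : ℝ), by
    constructor
    · exact Finset.sum_nonneg fun i _ => mul_nonneg (s.2.1 i) (l i).2.1
    · rw [← s.2.2]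
      exact Finset.sum_le_sum fun i _ => mul_le_of_le_one_right (s.2.1 i) (l i).2.2⟩
  cont l := by
    refine Continuous.subtype_mk ?_ _
    refine continuous_finsetSum _ fun i _ => ?_
    have h : Continuous fun s : Dl _ => s i := (continuous_apply i).comp continuous_subtype_val
    exact h.mul continuous_const
  vert l i := by
    refine Subtype.ext ?_
    dsimp only
    rw [Finset.sum_eq_single i]
    · simp
    · intro b _ hb; simp [hb]
    · simp
  assoc w t s := by
    refine Subtype.ext ?_
    simp only [scomb_apply, Finset.mul_sum, Finset.sum_mul]
    rw [Finset.sum_comm]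
    simp only [mul_assoc]

noncomputable instance {K K' : Type} [TopologicalSpace K] [TopologicalSpace K'] [Cvx K] [Cvx K'] :
    Cvx (K × K') where
  comb l s := (Cvx.comb (fun i => (l i).1) s, Cvx.comb (fun i => (l i).2) s)
  cont l := (Cvx.cont _).prodMk (Cvx.cont _)
  vert l i := by simp [Cvx.vert]
  assoc w t s := by simp [Cvx.assoc]

noncomputable instance : Cvx PUnit where
  comb _ _ := ⟨⟩
  cont _ := continuous_const
  vert _ _ := rfl
  assoc _ _ _ := rfl

/-- Maps compatible with convex combinations. -/
def Aff {K K' : Type} [TopologicalSpace K] [TopologicalSpace K'] [Cvx K] [Cvx K']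
    (f : K → K') : Prop :=
  ∀ {n : ℕ} (l : Fin n → K) (s : Dl n), f (Cvx.comb l s) = Cvx.comb (f ∘ l) s

theorem aff_comb {K : Type} [TopologicalSpace K] [Cvx K] {m : ℕ} (w : Fin m → K) :
    Aff (Cvx.comb w : Dl m → K) := by
  intro n l s
  exact (Cvx.assoc w l s).symm

/-- The tautological sequence of vertices. -/
noncomputable def vtx (n : ℕ) : Fin n → Dl n := fun i => stdSimplex.vertex i

theorem comb_vtx (n : ℕ) (s : Dl n) : Cvx.comb (vtx n) s = s := by
  refine stdSimplex.ext (funext fun j => ?_)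
  change scomb _ s j = _
  rw [scomb_apply, Finset.sum_eq_single j]
  · simp [vtx]
  · intro b _ hb; simp [vtx, hb.symm]
  · simp

theorem comb_comp_vtx {K : Type} [TopologicalSpace K] [Cvx K] {m : ℕ} (w : Fin m → K) :
    (Cvx.comb w) ∘ vtx m = w := funext fun i => Cvx.vert w i

/-! ### Subdivision of formal chains -/

/-- The barycenter of a sequence. -/
noncomputable def bary {K : Type} [TopologicalSpace K] [Cvx K] {n : ℕ} (l : Fin (n + 1) → K) : K :=
  Cvx.comb l stdSimplex.barycenter

theorem aff_bary {K K' : Type} [TopologicalSpace K] [TopologicalSpace K'] [Cvx K] [Cvx K']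
    {f : K → K'} (hf : Aff f) {n : ℕ} (l : Fin (n + 1) → K) : f (bary l) = bary (f ∘ l) := hf _ _

/-- Values of the subdivision operator. -/
noncomputable def sdFun {K : Type} [TopologicalSpace K] [Cvx K] : ∀ n, (Fin n → K) → LC K
  | 0, l => pt l
  | n + 1, l => cone (bary l) (∑ i : Fin (n + 1), (-1 : ℤ) ^ (i : ℕ) • sdFun n (l ∘ i.succAbove))

/-- Values of the subdivision homotopy. -/
noncomputable def shFun {K : Type} [TopologicalSpace K] [Cvx K] : ∀ n, (Fin n → K) → LC K
  | 0, _ => 0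
  | n + 1, l => cone (bary l)
      (pt l - ∑ i : Fin (n + 1), (-1 : ℤ) ^ (i : ℕ) • shFun n (l ∘ i.succAbove))

section
variable {K : Type} [TopologicalSpace K] [Cvx K]

/-- Barycentric subdivision of formal chains. -/
noncomputable def sd : LC K →ₗ[ℤ] LC K := lift sdFun

/-- The homotopy between the identity and the barycentric subdivision. -/
noncomputable def sh : LC K →ₗ[ℤ] LC K := lift shFun

theorem sd_pt_zero (l : Fin 0 → K) : sd (pt l) = pt l := by simp [sd, sdFun]

theorem sh_pt_zero (l : Fin 0 → K) : sh (pt l) = 0 := by simp [sh, shFun]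

theorem sd_pt_succ {n : ℕ} (l : Fin (n + 1) → K) :
    sd (pt l) = cone (bary l) (sd (bd (pt l))) := by
  rw [bd_pt_succ, map_sum]
  simp only [map_zsmul]
  simp [sd, sdFun]

theorem sh_pt_succ {n : ℕ} (l : Fin (n + 1) → K) :
    sh (pt l) = cone (bary l) (pt l - sh (bd (pt l))) := by
  rw [bd_pt_succ, map_sum (sh)]
  simp only [map_zsmul]
  simp [sh, shFun]

theorem bd_sd_pt {n : ℕ} : ∀ l : Fin n → K, bd (sd (pt l)) = sd (bd (pt l)) := by
  induction n with
  | zero => intro l; simp [sd_pt_zero, bd_pt_zero]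
  | succ n ih =>
    intro l
    have h : bd (sd (bd (pt l))) = sd (bd (bd (pt l))) := by
      rw [bd_pt_succ]
      simp only [map_sum, map_zsmul, ih]
    rw [sd_pt_succ, bd_cone, h, bd_bd]
    simp

theorem bd_sd (c : LC K) : bd (sd c) = sd (bd c) := by
  have : bd.comp (sd (K := K)) = sd.comp bd := lc_ext fun n l => bd_sd_pt l
  exact LinearMap.congr_fun this c

theorem bd_sh_pt {n : ℕ} : ∀ l : Fin n → K,
    bd (sh (pt l)) = pt l - sd (pt l) - sh (bd (pt l)) := by
  induction n with
  | zero => intro l; simp [sd_pt_zero, sh_pt_zero, bd_pt_zero]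
  | succ n ih =>
    intro l
    have h : bd (sh (bd (pt l))) = bd (pt l) - sd (bd (pt l)) - sh (bd (bd (pt l))) := by
      rw [bd_pt_succ]
      simp only [map_sum, map_zsmul, ih, smul_sub, Finset.sum_sub_distrib]
    rw [sh_pt_succ, bd_cone, map_sub, h, bd_bd, sd_pt_succ]
    simp only [map_zero, map_sub]
    abel

theorem bd_sh (c : LC K) : bd (sh c) = c - sd c - sh (bd c) := by
  have : bd.comp (sh (K := K)) = LinearMap.id - sd - sh.comp bd := lc_ext fun n l => bd_sh_pt l
  exact LinearMap.congr_fun this c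

variable {K' : Type} [TopologicalSpace K'] [Cvx K']

theorem lmap_sd {f : K → K'} (hf : Aff f) (c : LC K) : lmap f (sd c) = sd (lmap f c) := by
  have : (lmap f).comp sd = sd.comp (lmap f) := by
    refine lc_ext fun n => ?_
    induction n with
    | zero => intro l; simp [sd_pt_zero]
    | succ n ih =>
      intro l
      simp only [LinearMap.comp_apply, lmap_pt] at ih ⊢
      have h : lmap f (sd (bd (pt l))) = sd (bd (pt (f ∘ l))) := by
        rw [bd_pt_succ, bd_pt_succ]
        simp only [map_sum, map_zsmul, ih]
        rfl
      rw [sd_pt_succ, sd_pt_succ, lmap_cone, h, aff_bary hf]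
  exact LinearMap.congr_fun this c

theorem lmap_sh {f : K → K'} (hf : Aff f) (c : LC K) : lmap f (sh c) = sh (lmap f c) := by
  have : (lmap f).comp sh = sh.comp (lmap f) := by
    refine lc_ext fun n => ?_
    induction n with
    | zero => intro l; simp [sh_pt_zero]
    | succ n ih =>
      intro l
      simp only [LinearMap.comp_apply, lmap_pt] at ih ⊢
      have h : lmap f (sh (bd (pt l))) = sh (bd (pt (f ∘ l))) := by
        rw [bd_pt_succ, bd_pt_succ]
        simp only [map_sum, map_zsmul, ih]
        rfl
      rw [sh_pt_succ, sh_pt_succ, lmap_cone, map_sub, h, aff_bary hf, lmap_pt]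
  exact LinearMap.congr_fun this c

end

/-! ### The prism operator on formal chains -/

/-- Values of the prism operator. -/
noncomputable def prFun {K : Type} : ∀ n, (Fin n → K) → LC (K × unitInterval)
  | 0, _ => 0
  | n + 1, l => cone (l 0, 0) (cone (l 0, 1) (pt fun i => (Fin.tail l i, 1)))
      - cone (l 0, 0) (prFun n (Fin.tail l))

/-- The prism operator. -/
noncomputable def pr {K : Type} : LC K →ₗ[ℤ] LC (K × unitInterval) := lift prFun

theorem pr_cone {K : Type} (v : K) (c : LC K) :
    pr (cone v c) = cone (v, 0) (cone (v, 1) (lmap (fun x => (x, 1)) c))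
      - cone (v, 0) (pr c) := by
  have : pr.comp (cone v) = (cone (v, 0)).comp ((cone (v, 1)).comp (lmap (fun x => (x, 1))))
      - (cone (v, 0)).comp pr := by
    refine lc_ext fun n l => ?_
    simp [pr, prFun]
    rfl
  exact LinearMap.congr_fun this c

theorem bd_pr_pt {K : Type} {n : ℕ} : ∀ l : Fin n → K,
    bd (pr (pt l)) = lmap (fun x => (x, 1)) (pt l) - lmap (fun x => (x, 0)) (pt l)
      - pr (bd (pt l)) := by
  induction n with
  | zero =>
    intro l
    have : (fun x : K => (x, (1 : unitInterval))) ∘ l = (fun x : K => (x, 0)) ∘ l := by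
      funext i; exact i.elim0
    simp [pr, prFun, bd_pt_zero, this]
  | succ n ih =>
    intro l
    have hl : pt l = cone (l 0) (pt (Fin.tail l)) := by simp
    rw [hl, pr_cone, bd_cone, map_sub bd, bd_cone, bd_cone, bd_cone, ih, lmap_cone, lmap_cone,
      map_sub pr, pr_cone, lmap_bd]
    simp only [map_sub]
    abel

theorem bd_pr {K : Type} (c : LC K) :
    bd (pr c) = lmap (fun x => (x, 1)) c - lmap (fun x => (x, 0)) c - pr (bd c) := by
  have : bd.comp (pr (K := K)) = lmap (fun x => (x, 1)) - lmap (fun x => (x, 0)) - pr.comp bd :=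
    lc_ext fun n l => bd_pr_pt l
  exact LinearMap.congr_fun this c

theorem lmap_pr {K K' : Type} (f : K → K') (c : LC K) :
    lmap (Prod.map f id) (pr c) = pr (lmap f c) := by
  have : (lmap (Prod.map f id)).comp pr = pr.comp (lmap f) := by
    refine lc_ext fun n => ?_
    induction n with
    | zero => intro l; simp [pr, prFun]
    | succ n ih =>
      intro l
      have hl : pt l = cone (l 0) (pt (Fin.tail l)) := by simp
      have h := ih (Fin.tail l)
      simp only [LinearMap.comp_apply] at h ⊢
      rw [hl, pr_cone, map_sub, lmap_cone, lmap_cone, lmap_cone, h, lmap_cone, pr_cone]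
      simp
      rfl
  exact LinearMap.congr_fun this c

end KEq


namespace KEq

/-! ### Singular chains (augmented, all degrees at once) -/

/-- Singular chains of all degrees, including the empty simplex. -/
abbrev SC (X : Type) [TopologicalSpace X] := (Σ n : ℕ, C(Dl n, X)) →₀ ℤ

section
variable {X Y Z : Type} [TopologicalSpace X] [TopologicalSpace Y] [TopologicalSpace Z]

/-- The generator attached to a singular simplex. -/
noncomputable def spt {n : ℕ} (s : C(Dl n, X)) : SC X := Finsupp.single ⟨n, s⟩ 1

/-- Linear extension of a function on singular simplices. -/
noncomputable def slift {M : Type} [AddCommGroup M] (F : ∀ n, C(Dl n, X) → M) : SC X →ₗ[ℤ] M :=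
  Finsupp.linearCombination ℤ fun a => F a.1 a.2

@[simp] theorem slift_spt {M : Type} [AddCommGroup M] (F : ∀ n, C(Dl n, X) → M) {n : ℕ}
    (s : C(Dl n, X)) : slift F (spt s) = F n s := by
  simp [slift, spt]

theorem sc_ext {M : Type} [AddCommGroup M] {f g : SC X →ₗ[ℤ] M}
    (h : ∀ n (s : C(Dl n, X)), f (spt s) = g (spt s)) : f = g :=
  lin_ext fun a => h a.1 a.2

/-- Functoriality of singular chains. -/
noncomputable def push (f : C(X, Y)) : SC X →ₗ[ℤ] SC Y := slift fun _ s => spt (f.comp s)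

@[simp] theorem push_spt (f : C(X, Y)) {n : ℕ} (s : C(Dl n, X)) :
    push f (spt s) = spt (f.comp s) := by simp [push]

theorem push_push (f : C(X, Y)) (g : C(Y, Z)) (c : SC X) :
    push g (push f c) = push (g.comp f) c := by
  have : (push g).comp (push f) = push (g.comp f) := sc_ext fun n s => by
    simp [ContinuousMap.comp_assoc]
  exact LinearMap.congr_fun this c

theorem push_id (c : SC X) : push (ContinuousMap.id X) c = c := by
  have : push (ContinuousMap.id X) = LinearMap.id := sc_ext fun n s => by simp
  exact LinearMap.congr_fun this c

/-- The face inclusions. -/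
noncomputable def face {n : ℕ} (i : Fin (n + 1)) : C(Dl n, Dl (n + 1)) :=
  ⟨Cvx.comb (vtx (n + 1) ∘ i.succAbove), Cvx.cont _⟩

theorem aff_face {n : ℕ} (i : Fin (n + 1)) : Aff (face i) := aff_comb _

/-- Values of the singular boundary. -/
noncomputable def sbFun : ∀ n, C(Dl n, X) → SC X
  | 0, _ => 0
  | n + 1, s => ∑ i : Fin (n + 1), (-1 : ℤ) ^ (i : ℕ) • spt (s.comp (face i))

/-- The singular boundary. -/
noncomputable def sb : SC X →ₗ[ℤ] SC X := slift sbFun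

theorem sb_spt_zero (s : C(Dl 0, X)) : sb (spt s) = 0 := by simp [sb, sbFun]

theorem sb_spt_succ {n : ℕ} (s : C(Dl (n + 1), X)) :
    sb (spt s) = ∑ i : Fin (n + 1), (-1 : ℤ) ^ (i : ℕ) • spt (s.comp (face i)) := by
  simp [sb, sbFun]

theorem push_sb (f : C(X, Y)) (c : SC X) : push f (sb c) = sb (push f c) := by
  have : (push f).comp sb = sb.comp (push f) := by
    refine sc_ext fun n s => ?_
    cases n with
    | zero => simp [sb_spt_zero]
    | succ n =>
      simp only [LinearMap.comp_apply, push_spt, sb_spt_succ, map_sum, map_zsmul]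
      rfl
  exact LinearMap.congr_fun this c

/-- The affine simplex on a sequence. -/
noncomputable def asx {K : Type} [TopologicalSpace K] [Cvx K] {n : ℕ} (l : Fin n → K) :
    C(Dl n, K) := ⟨Cvx.comb l, Cvx.cont l⟩

/-- Realization of formal chains. -/
noncomputable def rl {K : Type} [TopologicalSpace K] [Cvx K] : LC K →ₗ[ℤ] SC K :=
  lift fun _ l => spt (asx l)

@[simp] theorem rl_pt {K : Type} [TopologicalSpace K] [Cvx K] {n : ℕ} (l : Fin n → K) :
    rl (pt l) = spt (asx l) := by simp [rl]

theorem push_rl {K K' : Type} [TopologicalSpace K] [Cvx K] [TopologicalSpace K'] [Cvx K']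
    (f : C(K, K')) (hf : Aff f) (c : LC K) : push f (rl c) = rl (lmap f c) := by
  have : (push f).comp rl = rl.comp (lmap f) := by
    refine lc_ext fun n l => ?_
    simp only [LinearMap.comp_apply, push_spt, rl_pt, lmap_pt]
    congr 1
    ext s
    exact hf l s
  exact LinearMap.congr_fun this c

theorem asx_vtx (n : ℕ) : asx (vtx n) = ContinuousMap.id _ := by
  ext1 s
  exact comb_vtx n s

theorem asx_comp_face {K : Type} [TopologicalSpace K] [Cvx K] {n : ℕ} (l : Fin (n + 1) → K)
    (i : Fin (n + 1)) : (asx l).comp (face i) = asx (l ∘ i.succAbove) := by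
  ext s
  change Cvx.comb l (Cvx.comb _ s) = Cvx.comb _ s
  rw [aff_comb l, ← Function.comp_assoc, comb_comp_vtx]

theorem aff_asx {K : Type} [TopologicalSpace K] [Cvx K] {n : ℕ} (l : Fin n → K) :
    Aff (asx l) := aff_comb l

theorem lmap_asx {K : Type} [TopologicalSpace K] [Cvx K] {n : ℕ} (l : Fin n → K) :
    lmap (asx l) (pt (vtx n)) = pt l := by
  rw [lmap_pt]
  exact congrArg pt (comb_comp_vtx l)

theorem sb_rl {K : Type} [TopologicalSpace K] [Cvx K] (c : LC K) : sb (rl c) = rl (bd c) := by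
  have : sb.comp (rl (K := K)) = rl.comp bd := by
    refine lc_ext fun n l => ?_
    cases n with
    | zero => simp [sb_spt_zero, bd_pt_zero]
    | succ n =>
      simp only [LinearMap.comp_apply, rl_pt, sb_spt_succ, bd_pt_succ, map_sum, map_zsmul,
        asx_comp_face]
  exact LinearMap.congr_fun this c

theorem spt_eq {n : ℕ} (s : C(Dl n, X)) : spt s = push s (rl (pt (vtx n))) := by
  simp [asx_vtx]

theorem sb_sb (c : SC X) : sb (sb c) = 0 := by
  have : (sb (X := X)).comp sb = 0 := by
    refine sc_ext fun n s => ?_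
    simp only [LinearMap.comp_apply]
    rw [spt_eq, ← push_sb, ← push_sb, sb_rl, sb_rl, bd_bd]
    simp
  exact LinearMap.congr_fun this c

theorem face_comp_vtx {n : ℕ} (i : Fin (n + 1)) :
    (face i) ∘ vtx n = vtx (n + 1) ∘ i.succAbove := comb_comp_vtx _

/-- The boundary of the tautological simplex. -/
theorem bd_vtx (n : ℕ) : bd (pt (vtx (n + 1)))
    = ∑ i : Fin (n + 1), (-1 : ℤ) ^ (i : ℕ) • lmap (face i) (pt (vtx n)) := by
  simp only [bd_pt_succ, lmap_pt, face_comp_vtx]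

/-! ### Subdivision of singular chains -/

/-- Barycentric subdivision. -/
noncomputable def ssd : SC X →ₗ[ℤ] SC X := slift fun n s => push s (rl (sd (pt (vtx n))))

/-- The subdivision homotopy. -/
noncomputable def ssh : SC X →ₗ[ℤ] SC X := slift fun n s => push s (rl (sh (pt (vtx n))))

@[simp] theorem ssd_spt {n : ℕ} (s : C(Dl n, X)) :
    ssd (spt s) = push s (rl (sd (pt (vtx n)))) := by simp [ssd]

@[simp] theorem ssh_spt {n : ℕ} (s : C(Dl n, X)) :
    ssh (spt s) = push s (rl (sh (pt (vtx n)))) := by simp [ssh]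

theorem ssd_sb_spt {n : ℕ} (s : C(Dl n, X)) :
    ssd (sb (spt s)) = push s (rl (sd (bd (pt (vtx n))))) := by
  cases n with
  | zero => simp [sb_spt_zero, bd_pt_zero]
  | succ n =>
    rw [bd_vtx, sb_spt_succ]
    simp only [map_sum, map_zsmul, ssd_spt]
    refine Finset.sum_congr rfl fun i _ => ?_
    rw [← lmap_sd (aff_face i), ← push_rl _ (aff_face i), push_push]

theorem ssh_sb_spt {n : ℕ} (s : C(Dl n, X)) :
    ssh (sb (spt s)) = push s (rl (sh (bd (pt (vtx n))))) := by
  cases n with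
  | zero => simp [sb_spt_zero, bd_pt_zero]
  | succ n =>
    rw [bd_vtx, sb_spt_succ]
    simp only [map_sum, map_zsmul, ssh_spt]
    refine Finset.sum_congr rfl fun i _ => ?_
    rw [← lmap_sh (aff_face i), ← push_rl _ (aff_face i), push_push]

theorem sb_ssd (c : SC X) : sb (ssd c) = ssd (sb c) := by
  have : sb.comp (ssd (X := X)) = ssd.comp sb := by
    refine sc_ext fun n s => ?_
    simp only [LinearMap.comp_apply]
    rw [ssd_sb_spt, ssd_spt, ← push_sb, sb_rl, bd_sd]
  exact LinearMap.congr_fun this c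

theorem sb_ssh (c : SC X) : sb (ssh c) = c - ssd c - ssh (sb c) := by
  have : sb.comp (ssh (X := X)) = LinearMap.id - ssd - ssh.comp sb := by
    refine sc_ext fun n s => ?_
    simp only [LinearMap.comp_apply, LinearMap.sub_apply, LinearMap.id_apply]
    rw [ssh_sb_spt, ssh_spt, ssd_spt, ← push_sb, sb_rl, bd_sh, map_sub, map_sub, map_sub, map_sub,
      ← spt_eq]
  exact LinearMap.congr_fun this c

theorem push_ssd (f : C(X, Y)) (c : SC X) : push f (ssd c) = ssd (push f c) := by
  have : (push f).comp ssd = ssd.comp (push f) := by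
    refine sc_ext fun n s => ?_
    simp [push_push]
  exact LinearMap.congr_fun this c

theorem ssd_rl {K : Type} [TopologicalSpace K] [Cvx K] (c : LC K) : ssd (rl c) = rl (sd c) := by
  have : ssd.comp (rl (K := K)) = rl.comp sd := by
    refine lc_ext fun n l => ?_
    simp only [LinearMap.comp_apply, rl_pt, ssd_spt]
    rw [push_rl _ (aff_asx l), lmap_sd (aff_asx l), lmap_asx]
  exact LinearMap.congr_fun this c

theorem ssd_pow_spt {n : ℕ} (s : C(Dl n, X)) (m : ℕ) :
    (ssd ^ m) (spt s) = push s (rl ((sd ^ m) (pt (vtx n)))) := by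
  induction m with
  | zero => simpa using spt_eq s
  | succ m ih =>
    rw [pow_succ', pow_succ', Module.End.mul_apply, Module.End.mul_apply, ih, ← push_ssd, ssd_rl]

/-! ### Homotopy invariance -/

/-- The prism operator. -/
noncomputable def spr : SC X →ₗ[ℤ] SC (X × unitInterval) :=
  slift fun n s => push (s.prodMap (ContinuousMap.id _)) (rl (pr (pt (vtx n))))

@[simp] theorem spr_spt {n : ℕ} (s : C(Dl n, X)) :
    spr (spt s) = push (s.prodMap (ContinuousMap.id _)) (rl (pr (pt (vtx n)))) := by simp [spr]

/-- The inclusion at a given time. -/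
def atTime (X : Type) [TopologicalSpace X] (t : unitInterval) : C(X, X × unitInterval) :=
  ⟨fun x => (x, t), by fun_prop⟩

theorem comb_const {n : ℕ} (t : unitInterval) (s : Dl n) :
    Cvx.comb (fun _ : Fin n => t) s = t := by
  refine Subtype.ext ?_
  change ∑ i, s i * (t : ℝ) = t
  rw [← Finset.sum_mul, stdSimplex.sum_eq_one, one_mul]

theorem aff_atTime {K : Type} [TopologicalSpace K] [Cvx K] (t : unitInterval) :
    Aff (atTime K t) := by
  intro n l s
  change (Cvx.comb l s, t) = (Cvx.comb _ s, Cvx.comb (fun _ => t) s)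
  rw [comb_const]
  rfl

theorem aff_prodMap {K K' : Type} [TopologicalSpace K] [Cvx K] [TopologicalSpace K'] [Cvx K']
    (f : K → K') (hf : Aff f) : Aff (Prod.map f (id : unitInterval → unitInterval)) := by
  intro n l s
  change (f (Cvx.comb _ s), Cvx.comb _ s) = (Cvx.comb _ s, Cvx.comb _ s)
  rw [hf]
  rfl

theorem sb_spr (c : SC X) :
    sb (spr c) = push (atTime X 1) c - push (atTime X 0) c - spr (sb c) := by
  have : sb.comp (spr (X := X)) = push (atTime X 1) - push (atTime X 0) - spr.comp sb := by
    refine sc_ext fun n s => ?_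
    simp only [LinearMap.comp_apply, LinearMap.sub_apply]
    have h1 : ∀ t, push (s.prodMap (ContinuousMap.id _)) (rl (lmap (fun x => (x, t)) (pt (vtx n))))
        = push (atTime X t) (spt s) := by
      intro t
      have := push_rl (atTime (Dl n) t) (aff_atTime t) (pt (vtx n))
      rw [show lmap (fun x => (x, t)) (pt (vtx n)) = lmap (atTime (Dl n) t) (pt (vtx n)) from rfl,
        ← this, push_push, spt_eq s, push_push]
      rfl
    have h2 : spr (sb (spt s)) =
        push (s.prodMap (ContinuousMap.id _)) (rl (pr (bd (pt (vtx n))))) := by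
      cases n with
      | zero => simp [sb_spt_zero, bd_pt_zero]
      | succ n =>
        rw [bd_vtx, sb_spt_succ]
        simp only [map_sum, map_zsmul, spr_spt]
        refine Finset.sum_congr rfl fun i _ => ?_
        rw [← lmap_pr]
        have := push_rl ((face i).prodMap (ContinuousMap.id unitInterval))
          (aff_prodMap _ (aff_face i)) (pr (pt (vtx n)))
        change _ = _ • push _ (rl (lmap ((face i).prodMap (ContinuousMap.id unitInterval)) _))
        rw [← this, push_push]
        rfl
    rw [h2, spr_spt, ← push_sb, sb_rl, bd_pr, map_sub, map_sub, map_sub, map_sub, h1, h1]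
  exact LinearMap.congr_fun this c

theorem homotopic_push {f g : C(X, Y)} (h : f.Homotopic g) {z : SC X} (hz : sb z = 0) :
    ∃ w, push f z - push g z = sb w := by
  obtain ⟨H⟩ := h.symm
  let H' : C(X × unitInterval, Y) := ⟨fun p => H (p.2, p.1), by fun_prop⟩
  have h0 : H'.comp (atTime X 0) = g := by ext x; simp [H', atTime]
  have h1 : H'.comp (atTime X 1) = f := by ext x; simp [H', atTime]
  refine ⟨push H' (spr z), ?_⟩
  rw [← push_sb, sb_spr, hz, map_sub, map_sub, push_push, push_push, h0, h1]
  simp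

/-! ### A point -/

theorem punit_acyclic {z : SC PUnit} (hz : sb z = 0) : ∃ w, z = sb w := by
  let ps : SC PUnit →ₗ[ℤ] LC PUnit := slift fun n _ => pt fun _ : Fin n => PUnit.unit
  have h1 : ∀ c, rl (ps c) = c := by
    intro c
    have : rl.comp ps = LinearMap.id := by
      refine sc_ext fun n s => ?_
      simp only [LinearMap.comp_apply, ps, slift_spt, rl_pt, LinearMap.id_apply]
      congr 1
    exact LinearMap.congr_fun this c
  have h2 : ∀ c, ps (rl c) = c := by
    intro c
    have : ps.comp rl = LinearMap.id := by
      refine lc_ext fun n s => ?_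
      simp only [LinearMap.comp_apply, ps, slift_spt, rl_pt, LinearMap.id_apply]
    exact LinearMap.congr_fun this c
  have h3 : bd (ps z) = 0 := by
    rw [← h2 (bd (ps z)), ← sb_rl, h1, hz, map_zero]
  refine ⟨rl (cone PUnit.unit (ps z)), ?_⟩
  rw [sb_rl, bd_cone, h3, map_zero, sub_zero, h1]

end
end KEq


namespace KEq

/-! ### Algebra: torsion-free homology of a subcomplex -/

section
variable {M : Type} [AddCommGroup M] (d : M →ₗ[ℤ] M)

/-- The homology of the subcomplex `P` of `(M, d)` is torsion free. -/
def TFsub (P : Submodule ℤ M) : Prop :=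
  ∀ z ∈ P, d z = 0 → ∀ c : ℤ, c ≠ 0 → (∃ w ∈ P, c • z = d w) → ∃ w ∈ P, z = d w

/-- Every chain of `P` with boundary in `A ⊔ B` can be moved to `A ⊔ B`. -/
def SmallSub (P A B : Submodule ℤ M) : Prop :=
  ∀ u ∈ P, d u ∈ A ⊔ B → ∃ u' ∈ A ⊔ B, ∃ v ∈ P, u = u' + d v

variable {d}

theorem alg_one {P A B : Submodule ℤ M} (hd : ∀ x, d (d x) = 0)
    (hAP : A ≤ P) (hBP : B ≤ P) (dA : ∀ x ∈ A, d x ∈ A) (dB : ∀ x ∈ B, d x ∈ B)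
    (small : SmallSub d P A B) (hI : TFsub d (A ⊓ B)) (hP : TFsub d P)
    (surj : ∀ e ∈ P, d e = 0 → ∃ a ∈ A, d a = 0 ∧ ∃ f ∈ P, e = a + d f) : TFsub d A := by
  intro z hz dz c hc ⟨w, hw, hcw⟩
  obtain ⟨u, hu, hzu⟩ := hP z (hAP hz) dz c hc ⟨w, hAP hw, hcw⟩
  obtain ⟨u', hu', v, hv, huv⟩ := small u hu (by rw [← hzu]; exact Submodule.mem_sup_left hz)
  obtain ⟨a, ha, b, hb, rfl⟩ := Submodule.mem_sup.1 hu'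
  have hz' : z = d a + d b := by rw [hzu, huv, map_add, hd, add_zero, map_add]
  have hy : d b ∈ A ⊓ B := by
    refine ⟨?_, dB b hb⟩
    rw [show d b = z - d a by rw [hz']; abel]
    exact A.sub_mem hz (dA a ha)
  have he : w - c • a - c • b ∈ P :=
    P.sub_mem (P.sub_mem (hAP hw) (P.smul_mem _ (hAP ha))) (P.smul_mem _ (hBP hb))
  have hde : d (w - c • a - c • b) = 0 := by
    rw [map_sub, map_sub, map_smul, map_smul, ← hcw, hz', smul_add]; abel
  obtain ⟨a', ha', da', f, hf, hef⟩ := surj _ he hde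
  have hdf : d f ∈ A ⊔ B := by
    rw [show d f = (w - c • a - a') + (-(c • b)) by
      rw [show d f = (w - c • a - c • b) - a' by rw [hef]; abel]; abel]
    exact Submodule.add_mem_sup (A.sub_mem (A.sub_mem hw (A.smul_mem _ ha)) ha')
      (B.neg_mem (B.smul_mem _ hb))
  obtain ⟨f', hf', g, hg, hfg⟩ := small f hf hdf
  obtain ⟨a2, ha2, b2, hb2, rfl⟩ := Submodule.mem_sup.1 hf'
  have hdf2 : d f = d a2 + d b2 := by rw [hfg, map_add, hd, add_zero, map_add]
  have hq : c • b + d b2 ∈ A ⊓ B := by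
    refine ⟨?_, B.add_mem (B.smul_mem _ hb) (dB _ hb2)⟩
    rw [show c • b + d b2 = w - c • a - a' - d a2 by
      have h3 : w - c • a - c • b = a' + (d a2 + d b2) := by rw [hef, hdf2]
      rw [sub_eq_iff_eq_add] at h3
      rw [h3]; abel]
    exact A.sub_mem (A.sub_mem (A.sub_mem hw (A.smul_mem _ ha)) ha') (dA _ ha2)
  obtain ⟨q', hq', hbq⟩ := hI (d b) hy (hd b) c hc
    ⟨c • b + d b2, hq, by rw [map_add, hd, add_zero, map_smul]⟩
  exact ⟨a + q', A.add_mem ha hq'.1, by rw [hz', hbq, map_add]⟩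

theorem alg_split {P A B : Submodule ℤ M} (hd : ∀ x, d (d x) = 0)
    (hAP : A ≤ P) (hBP : B ≤ P) (dA : ∀ x ∈ A, d x ∈ A) (dB : ∀ x ∈ B, d x ∈ B)
    (small : SmallSub d P A B) (hI : TFsub d (A ⊓ B))
    {x : M} (hx : x ∈ P) (dx : d x = 0) {c : ℤ} (hc : c ≠ 0) (hw : ∃ w ∈ P, c • x = d w) :
    ∃ a ∈ A, ∃ b ∈ B, ∃ v ∈ P, x = a + b + d v ∧ d a = 0 ∧ d b = 0 ∧
      ∃ wA ∈ A, ∃ wB ∈ B, c • a - d wA = -(c • b - d wB) ∧ c • a - d wA ∈ A ⊓ B := by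
  obtain ⟨w, hw, hcw⟩ := hw
  obtain ⟨x', hx', v, hv, hxv⟩ := small x hx (by rw [dx]; exact Submodule.zero_mem _)
  obtain ⟨a, ha, b, hb, rfl⟩ := Submodule.mem_sup.1 hx'
  have hd0 : d a + d b = 0 := by
    rw [← map_add, ← dx, hxv, map_add d _ (d v), hd, add_zero]
  have h1 : d (w - c • v) = c • a + c • b := by
    rw [map_sub, ← hcw, hxv, map_smul, smul_add, smul_add]; abel
  obtain ⟨w', hw', t, ht, hwt⟩ := small (w - c • v) (P.sub_mem hw (P.smul_mem _ hv)) (by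
    rw [h1]; exact Submodule.add_mem_sup (A.smul_mem _ ha) (B.smul_mem _ hb))
  obtain ⟨wA, hwA, wB, hwB, rfl⟩ := Submodule.mem_sup.1 hw'
  have h2 : c • a + c • b = d wA + d wB := by
    rw [← h1, hwt, map_add, hd, add_zero, map_add]
  have h3 : c • a - d wA = -(c • b - d wB) := by
    rw [eq_neg_iff_add_eq_zero, show c • a - d wA + (c • b - d wB)
      = (c • a + c • b) - (d wA + d wB) by abel, h2, sub_self]
  have h4 : c • a - d wA ∈ A ⊓ B := by
    refine ⟨A.sub_mem (A.smul_mem _ ha) (dA _ hwA), ?_⟩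
    rw [h3]
    exact B.neg_mem (B.sub_mem (B.smul_mem _ hb) (dB _ hwB))
  have hda : d a ∈ A ⊓ B := by
    refine ⟨dA a ha, ?_⟩
    rw [eq_neg_of_add_eq_zero_left hd0]
    exact B.neg_mem (dB b hb)
  obtain ⟨q, hq, hq2⟩ := hI (d a) hda (hd a) c hc
    ⟨_, h4, by rw [map_sub, hd, sub_zero, map_smul]⟩
  refine ⟨a - q, A.sub_mem ha hq.1, b + q, B.add_mem hb hq.2, v, hv, ?_, ?_, ?_,
    wA, hwA, wB, hwB, ?_, ?_⟩
  · rw [hxv]; abel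
  · rw [map_sub, hq2, sub_self]
  · rw [map_add, ← hq2, add_comm, hd0]
  · rw [smul_sub, smul_add, show c • a - c • q - d wA = (c • a - d wA) - c • q by abel, h3]; abel
  · rw [smul_sub, show c • a - c • q - d wA = (c • a - d wA) - c • q by abel]
    exact Submodule.sub_mem _ h4 (Submodule.smul_mem _ _ hq)

theorem alg_two {P A B : Submodule ℤ M} (hd : ∀ x, d (d x) = 0)
    (hAP : A ≤ P) (hBP : B ≤ P) (dA : ∀ x ∈ A, d x ∈ A) (dB : ∀ x ∈ B, d x ∈ B)
    (small : SmallSub d P A B) (hI : TFsub d (A ⊓ B))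
    (surj : ∀ b ∈ B, d b = 0 → ∃ p ∈ A ⊓ B, d p = 0 ∧ ∃ f ∈ B, b = p + d f)
    (inj : ∀ a ∈ A, d a = 0 → ∀ c : ℤ, c ≠ 0 → (∃ w ∈ P, c • a = d w) → ∃ w ∈ A, a = d w) :
    TFsub d P := by
  intro x hx dx c hc hw
  obtain ⟨a, ha, b, hb, v, hv, hxv, da, db, -⟩ :=
    alg_split hd hAP hBP dA dB small hI hx dx hc hw
  obtain ⟨p, hp, dp, f, hf, hbf⟩ := surj b hb db
  obtain ⟨w, hw, hcw⟩ := hw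
  obtain ⟨w', hw', h'⟩ := inj (a + p) (A.add_mem ha hp.1) (by rw [map_add, da, dp, add_zero]) c hc
    ⟨w - c • f - c • v, P.sub_mem (P.sub_mem hw (P.smul_mem _ (hBP hf))) (P.smul_mem _ hv), by
      rw [map_sub, map_sub, ← hcw, hxv, hbf, map_smul, map_smul]
      simp only [smul_add]; abel⟩
  refine ⟨w' + f + v, P.add_mem (P.add_mem (hAP hw') (hBP hf)) hv, ?_⟩
  rw [map_add, map_add, ← h', hxv, hbf]; abel

theorem alg_three {P A B : Submodule ℤ M} (hd : ∀ x, d (d x) = 0)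
    (hAP : A ≤ P) (hBP : B ≤ P) (dA : ∀ x ∈ A, d x ∈ A) (dB : ∀ x ∈ B, d x ∈ B)
    (small : SmallSub d P A B) (hI : TFsub d (A ⊓ B))
    (hA : TFsub d A) (hB : TFsub d B)
    (zA : ∀ q ∈ A ⊓ B, d q = 0 → ∃ w ∈ A, q = d w)
    (zB : ∀ q ∈ A ⊓ B, d q = 0 → ∃ w ∈ B, q = d w) :
    TFsub d P := by
  intro x hx dx c hc hw
  obtain ⟨a, ha, b, hb, v, hv, hxv, da, db, wA, hwA, wB, hwB, h3, h4⟩ :=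
    alg_split hd hAP hBP dA dB small hI hx dx hc hw
  have h5 : d (c • a - d wA) = 0 := by rw [map_sub, hd, map_smul, da]; simp
  obtain ⟨qA, hqA, eA⟩ := zA _ h4 h5
  obtain ⟨qB, hqB, eB⟩ := zB _ h4 h5
  obtain ⟨sA, hsA, fA⟩ := hA a ha da c hc ⟨qA + wA, A.add_mem hqA hwA, by
    rw [map_add, ← eA]; abel⟩
  obtain ⟨sB, hsB, fB⟩ := hB b hb db c hc ⟨wB - qB, B.sub_mem hwB hqB, by
    rw [map_sub, ← eB, h3]; abel⟩
  refine ⟨sA + sB + v, P.add_mem (P.add_mem (hAP hsA) (hBP hsB)) hv, ?_⟩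
  rw [map_add, map_add, ← fA, ← fB, hxv]

end

end KEq


namespace KEq

/-! ### Mesh estimates -/

theorem coe_comb {m n : ℕ} (l : Fin n → Dl m) (s : Dl n) :
    ((Cvx.comb l s : Dl m) : Fin m → ℝ) = ∑ i, s i • (l i : Fin m → ℝ) := rfl

theorem dist_comb_le {m n : ℕ} (l : Fin n → Dl m) (s : Dl n) (x : Dl m) (r : ℝ)
    (h : ∀ j, dist (l j) x ≤ r) : dist (Cvx.comb l s) x ≤ r := by
  have : ∑ i, s i • (l i : Fin m → ℝ) ∈ Metric.closedBall (x : Fin m → ℝ) r := by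
    refine (convex_closedBall (x : Fin m → ℝ) r).sum_mem ?_ ?_ ?_
    · intro i _; exact s.2.1 i
    · exact s.2.2
    · intro i _; exact h i
  exact this

theorem dist_bary_le {m n : ℕ} (l : Fin (n + 1) → Dl m) (d : ℝ)
    (h : ∀ i j, dist (l i) (l j) ≤ d) (j : Fin (n + 1)) :
    dist (l j) (bary l) ≤ (1 - 1 / (n + 1 : ℝ)) * d := by
  have hn : (0 : ℝ) < n + 1 := by positivity
  have e : (l j).1 - (bary l : Dl m).1
      = ∑ i, (1 / (n + 1 : ℝ)) • ((l j).1 - (l i).1) := by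
    have hb : (bary l : Dl m).1 = ∑ i, (1 / (n + 1 : ℝ)) • (l i).1 := by
      refine (coe_comb l stdSimplex.barycenter).trans ?_
      refine Finset.sum_congr rfl fun i _ => ?_
      have : (stdSimplex.barycenter : Dl (n + 1)) i = 1 / (n + 1 : ℝ) := by
        refine (stdSimplex.barycenter_apply (𝕜 := ℝ) i).trans ?_
        simp
      rw [this]
      rfl
    rw [hb]
    simp only [smul_sub, Finset.sum_sub_distrib]
    rw [Finset.sum_const, Finset.card_univ, Fintype.card_fin, ← Nat.cast_smul_eq_nsmul ℝ, smul_smul]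
    push_cast
    rw [mul_one_div_cancel hn.ne', one_smul]
  rw [Subtype.dist_eq, dist_eq_norm, e]
  refine (norm_sum_le _ _).trans ?_
  have hb : ∀ i, ‖(1 / (n + 1 : ℝ)) • ((l j).1 - (l i).1)‖
      ≤ if i = j then 0 else (1 / (n + 1 : ℝ)) * d := by
    intro i
    split_ifs with hij
    · subst hij; simp
    · rw [norm_smul, Real.norm_of_nonneg (by positivity)]
      refine mul_le_mul_of_nonneg_left ?_ (by positivity)
      have := h j i
      rwa [Subtype.dist_eq, dist_eq_norm] at this
  refine (Finset.sum_le_sum fun i _ => hb i).trans (le_of_eq ?_)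
  rw [Finset.sum_ite, Finset.sum_const_zero, zero_add, Finset.sum_const, nsmul_eq_mul]
  have : (Finset.univ.filter fun i : Fin (n + 1) => ¬ i = j).card = n := by
    rw [Finset.filter_ne' Finset.univ j, Finset.card_erase_of_mem (Finset.mem_univ _)]
    simp
  rw [this]
  field_simp
  ring

theorem sd_mesh {m N : ℕ} {d : ℝ} (hd : 0 ≤ d) {n : ℕ} (hn : n ≤ N) (l : Fin n → Dl m)
    (h : ∀ i j, dist (l i) (l j) ≤ d) :
    sd (pt l) ∈ Finsupp.supported ℤ ℤ {a : Σ n : ℕ, Fin n → Dl m | a.1 ≤ n ∧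
      (∀ x r, (∀ j, dist (l j) x ≤ r) → ∀ i, dist (a.2 i) x ≤ r) ∧
      ∀ i j, dist (a.2 i) (a.2 j) ≤ (1 - 1 / (N : ℝ)) * d} := by
  induction n with
  | zero =>
    rw [sd_pt_zero]
    refine Finsupp.single_mem_supported ℤ _ ⟨le_rfl, fun x r _ i => i.elim0, fun i => i.elim0⟩
  | succ n ih =>
    rw [sd_pt_succ]
    have hq : ∀ j, dist (l j) (bary l) ≤ (1 - 1 / (N : ℝ)) * d := by
      intro j
      refine (dist_bary_le l d h j).trans (mul_le_mul_of_nonneg_right ?_ hd)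
      have : (n + 1 : ℝ) ≤ N := by exact_mod_cast hn
      have : 1 / (N : ℝ) ≤ 1 / (n + 1 : ℝ) := one_div_le_one_div_of_le (by positivity) this
      linarith
    have h1 : sd (bd (pt l)) ∈ Finsupp.supported ℤ ℤ {a : Σ n : ℕ, Fin n → Dl m | a.1 ≤ n ∧
      (∀ x r, (∀ j, dist (l j) x ≤ r) → ∀ i, dist (a.2 i) x ≤ r) ∧
      ∀ i j, dist (a.2 i) (a.2 j) ≤ (1 - 1 / (N : ℝ)) * d} := by
      rw [bd_pt_succ, map_sum]
      refine Submodule.sum_mem _ fun i _ => ?_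
      rw [map_zsmul]
      refine Submodule.smul_mem _ _ ?_
      refine Finsupp.supported_mono ?_
        (ih (by omega) (l ∘ i.succAbove) (fun a b => h _ _))
      rintro a ⟨h1, h2, h3⟩
      exact ⟨h1, fun x r hx => h2 x r fun j => hx _, h3⟩
    refine lin_apply_mem _ _ ?_ h1
    rintro ⟨k, w⟩ ⟨h1, h2, h3⟩
    change cone (bary l) (pt w) ∈ _
    rw [cone_pt]
    refine Finsupp.single_mem_supported ℤ _ ⟨Nat.succ_le_succ h1, ?_, ?_⟩
    · intro x r hx i
      refine Fin.cases ?_ (fun i => ?_) i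
      · exact dist_comb_le l _ x r hx
      · simpa using h2 x r hx i
    · have hbw : ∀ i, dist (w i) (bary l) ≤ (1 - 1 / (N : ℝ)) * d := h2 _ _ hq
      have h0 : 0 ≤ (1 - 1 / (N : ℝ)) * d := le_trans dist_nonneg (hq 0)
      intro i j
      refine Fin.cases ?_ (fun i => ?_) i <;> refine Fin.cases ?_ (fun j => ?_) j
      · simpa using h0
      · simpa [dist_comm] using hbw j
      · simpa using hbw i
      · simpa using h3 i j

theorem sd_pow_mesh {m N : ℕ} (l : Fin N → Dl m) {d : ℝ} (hd : 0 ≤ d)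
    (h : ∀ i j, dist (l i) (l j) ≤ d) (q : ℕ) :
    (sd ^ q) (pt l) ∈ Finsupp.supported ℤ ℤ {a : Σ n : ℕ, Fin n → Dl m | a.1 ≤ N ∧
      ∀ i j, dist (a.2 i) (a.2 j) ≤ (1 - 1 / (N : ℝ)) ^ q * d} := by
  have h01 : 0 ≤ 1 - 1 / (N : ℝ) := by
    rcases Nat.eq_zero_or_pos N with rfl | hN
    · simp
    · have : (1 : ℝ) ≤ N := by exact_mod_cast hN
      have : 1 / (N : ℝ) ≤ 1 := by rw [div_le_one (by positivity)]; exact this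
      linarith
  induction q with
  | zero => exact Finsupp.single_mem_supported ℤ _ ⟨le_rfl, by simpa using h⟩
  | succ q ih =>
    have hp : (sd ^ (q + 1)) (pt l) = sd ((sd ^ q) (pt l)) := by
      rw [pow_succ', Module.End.mul_apply]
    rw [hp]
    refine lin_apply_mem _ _ ?_ ih
    rintro ⟨k, w⟩ ⟨h1, h2⟩
    refine Finsupp.supported_mono ?_ (sd_mesh (N := N) (by positivity) h1 w h2)
    rintro a ⟨h3, -, h5⟩
    refine ⟨h3.trans h1, fun i j => (h5 i j).trans (le_of_eq ?_)⟩
    ring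

/-! ### Chains supported in a subset -/

section
variable {X Y : Type} [TopologicalSpace X] [TopologicalSpace Y]

/-- Chains of simplices contained in a subset. -/
noncomputable def Ch (A : Set X) : Submodule ℤ (SC X) :=
  Finsupp.supported ℤ ℤ {a : Σ n : ℕ, C(Dl n, X) | ∀ p, a.2 p ∈ A}

theorem spt_mem {A : Set X} {n : ℕ} {s : C(Dl n, X)} (h : ∀ p, s p ∈ A) : spt s ∈ Ch A :=
  Finsupp.single_mem_supported ℤ _ h

theorem Ch_mem {A : Set X} {M : Type} [AddCommGroup M] (f : SC X →ₗ[ℤ] M) (N : Submodule ℤ M)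
    (h : ∀ n (s : C(Dl n, X)), (∀ p, s p ∈ A) → f (spt s) ∈ N) {x : SC X} (hx : x ∈ Ch A) :
    f x ∈ N :=
  lin_apply_mem f N (fun a ha => h a.1 a.2 ha) hx

theorem Ch_mono {A B : Set X} (h : A ⊆ B) : Ch A ≤ Ch B :=
  Finsupp.supported_mono fun _ ha p => h (ha p)

theorem Ch_inter (A B : Set X) : Ch (A ∩ B) = Ch A ⊓ Ch B := by
  rw [Ch, Ch, Ch, ← Finsupp.supported_inter]
  congr 1
  ext a
  exact forall_and

theorem Ch_univ : Ch (Set.univ : Set X) = ⊤ := by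
  rw [Ch, eq_top_iff, ← Finsupp.supported_univ]
  exact Finsupp.supported_mono fun _ _ p => trivial

theorem push_mem (f : C(X, Y)) {A : Set Y} (h : ∀ x, f x ∈ A) (c : SC X) : push f c ∈ Ch A := by
  refine Ch_mem (A := Set.univ) (push f) _ (fun n s _ => ?_) (by rw [Ch_univ]; trivial)
  rw [push_spt]
  exact spt_mem fun p => h _

theorem sb_mem {A : Set X} {c : SC X} (hc : c ∈ Ch A) : sb c ∈ Ch A := by
  refine Ch_mem sb _ (fun n s hs => ?_) hc
  rw [spt_eq, ← push_sb]
  exact push_mem _ hs _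

theorem ssd_mem {A : Set X} {c : SC X} (hc : c ∈ Ch A) : ssd c ∈ Ch A := by
  refine Ch_mem ssd _ (fun n s hs => ?_) hc
  rw [ssd_spt]
  exact push_mem _ hs _

theorem ssh_mem {A : Set X} {c : SC X} (hc : c ∈ Ch A) : ssh c ∈ Ch A := by
  refine Ch_mem ssh _ (fun n s hs => ?_) hc
  rw [ssh_spt]
  exact push_mem _ hs _

theorem sup_mem {A B : Set X} (f : SC X →ₗ[ℤ] SC X) (hA : ∀ c ∈ Ch A, f c ∈ Ch A)
    (hB : ∀ c ∈ Ch B, f c ∈ Ch B) {c : SC X} (hc : c ∈ Ch A ⊔ Ch B) : f c ∈ Ch A ⊔ Ch B := by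
  obtain ⟨a, ha, b, hb, rfl⟩ := Submodule.mem_sup.1 hc
  rw [map_add]
  exact Submodule.add_mem_sup (hA a ha) (hB b hb)

/-! ### Small simplices -/

theorem small_spt {A B : Set X} (hA : IsOpen A) (hB : IsOpen B) {n : ℕ} (s : C(Dl n, X))
    (hs : ∀ p, s p ∈ A ∪ B) : ∃ m, (ssd ^ m) (spt s) ∈ Ch A ⊔ Ch B := by
  rcases Nat.eq_zero_or_pos n with rfl | hn
  · refine ⟨0, Submodule.mem_sup_left ?_⟩
    refine spt_mem fun p => ?_
    have := p.2.2
    simp at this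
  have hcov : (Set.univ : Set (Dl n)) ⊆ ⋃ b : Bool, s ⁻¹' (if b then A else B) := by
    intro p _
    rcases hs p with h | h
    · exact Set.mem_iUnion.2 ⟨true, by simpa using h⟩
    · exact Set.mem_iUnion.2 ⟨false, by simpa using h⟩
  obtain ⟨δ, hδ, hleb⟩ := lebesgue_number_lemma_of_metric (isCompact_univ (X := Dl n))
    (c := fun b : Bool => s ⁻¹' (if b then A else B)) (fun b => by
      refine IsOpen.preimage s.continuous ?_
      cases b <;> simpa) hcov
  have hdist : ∀ i j, dist (vtx n i) (vtx n j) ≤ 1 := by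
    intro i j
    refine (Metric.dist_le_diam_of_mem (bounded_stdSimplex (Fin n)) (vtx n i).2 (vtx n j).2).trans ?_
    exact diam_stdSimplex_le
  have h01 : 0 ≤ 1 - 1 / (n : ℝ) ∧ 1 - 1 / (n : ℝ) < 1 := by
    have : (1 : ℝ) ≤ n := by exact_mod_cast hn
    have h1 : 1 / (n : ℝ) ≤ 1 := by rw [div_le_one (by positivity)]; exact this
    have h2 : 0 < 1 / (n : ℝ) := by positivity
    constructor <;> linarith
  obtain ⟨m, hm⟩ := exists_pow_lt_of_lt_one hδ h01.2
  refine ⟨m, ?_⟩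
  rw [ssd_pow_spt]
  have key := sd_pow_mesh (vtx n) zero_le_one hdist m
  refine lin_apply_mem ((push s).comp rl) _ ?_ key
  rintro ⟨k, w⟩ ⟨-, hw⟩
  change push s (rl (pt w)) ∈ _
  rw [rl_pt, push_spt]
  rcases Nat.eq_zero_or_pos k with rfl | hk
  · refine Submodule.mem_sup_left (spt_mem fun p => ?_)
    have := p.2.2
    simp at this
  obtain ⟨b, hb⟩ := hleb (w ⟨0, hk⟩) trivial
  have hin : ∀ p, s (asx w p) ∈ (if b then A else B) := by
    intro p
    refine hb ?_
    refine lt_of_le_of_lt (dist_comb_le w p (w ⟨0, hk⟩) _ fun j => hw j ⟨0, hk⟩) ?_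
    simpa using hm
  cases b
  · exact Submodule.mem_sup_right (spt_mem (by simpa using hin))
  · exact Submodule.mem_sup_left (spt_mem (by simpa using hin))

theorem ssd_pow_sup_mem {A B : Set X} {c : SC X} (hc : c ∈ Ch A ⊔ Ch B) (m : ℕ) :
    (ssd ^ m) c ∈ Ch A ⊔ Ch B := by
  induction m with
  | zero => simpa using hc
  | succ m ih =>
    rw [pow_succ', Module.End.mul_apply]
    exact sup_mem ssd (fun _ => ssd_mem) (fun _ => ssd_mem) ih

theorem small_exists {A B : Set X} (hA : IsOpen A) (hB : IsOpen B) {c : SC X}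
    (hc : c ∈ Ch (A ∪ B)) : ∃ m, (ssd ^ m) c ∈ Ch A ⊔ Ch B := by
  rw [Ch, Finsupp.supported_eq_span_single] at hc
  induction hc using Submodule.span_induction with
  | mem x hx =>
    obtain ⟨a, ha, rfl⟩ := hx
    exact small_spt hA hB a.2 ha
  | zero => exact ⟨0, by simp⟩
  | add x y _ _ hx hy =>
    obtain ⟨m, hm⟩ := hx
    obtain ⟨k, hk⟩ := hy
    refine ⟨k + m, ?_⟩
    rw [map_add]
    refine Submodule.add_mem _ ?_ ?_
    · rw [pow_add, Module.End.mul_apply]; exact ssd_pow_sup_mem hm k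
    · rw [add_comm, pow_add, Module.End.mul_apply]; exact ssd_pow_sup_mem hk m
  | smul r x _ hx =>
    obtain ⟨m, hm⟩ := hx
    refine ⟨m, ?_⟩
    rw [map_smul]
    exact Submodule.smul_mem _ _ hm

theorem small_iter {A B : Set X} (m : ℕ) : ∀ u ∈ Ch (A ∪ B), sb u ∈ Ch A ⊔ Ch B →
    ∃ t ∈ Ch A ⊔ Ch B, ∃ v ∈ Ch (A ∪ B), u = (ssd ^ m) u + t + sb v := by
  induction m with
  | zero => intro u _ _; exact ⟨0, Submodule.zero_mem _, 0, Submodule.zero_mem _, by simp⟩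
  | succ m ih =>
    intro u hu hbu
    obtain ⟨t, ht, v, hv, e⟩ := ih (ssd u) (ssd_mem hu) (by
      rw [sb_ssd]; exact sup_mem ssd (fun _ => ssd_mem) (fun _ => ssd_mem) hbu)
    refine ⟨t + ssh (sb u), Submodule.add_mem _ ht
      (sup_mem ssh (fun _ => ssh_mem) (fun _ => ssh_mem) hbu), v + ssh u,
      Submodule.add_mem _ hv (ssh_mem hu), ?_⟩
    rw [pow_succ, Module.End.mul_apply, map_add, sb_ssh]
    nth_rewrite 2 [e]
    abel

theorem small_sub {A B : Set X} (hA : IsOpen A) (hB : IsOpen B) :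
    SmallSub sb (Ch (A ∪ B)) (Ch A) (Ch B) := by
  intro u hu hbu
  obtain ⟨m, hm⟩ := small_exists hA hB hu
  obtain ⟨t, ht, v, hv, e⟩ := small_iter m u hu hbu
  exact ⟨_, Submodule.add_mem _ hm ht, v, hv, e⟩

end
end KEq


namespace KEq

section
variable {X Y T : Type} [TopologicalSpace X] [TopologicalSpace Y] [TopologicalSpace T]

/-- The (reduced) singular homology of `X` is torsion free. -/
def TFX (X : Type) [TopologicalSpace X] : Prop := TFsub sb (⊤ : Submodule ℤ (SC X))

theorem TFX_iff : TFX X ↔ ∀ z : SC X, sb z = 0 → ∀ c : ℤ, c ≠ 0 → (∃ w, c • z = sb w) →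
    ∃ w, z = sb w := by
  simp [TFX, TFsub]

/-- The inclusion of a subset. -/
def emb (A : Set X) : C(A, X) := ⟨Subtype.val, continuous_subtype_val⟩

/-- The inclusion of subsets. -/
def inc {A B : Set X} (h : A ⊆ B) : C(A, B) := ⟨Set.inclusion h, continuous_inclusion h⟩

theorem emb_comp_inc {A B : Set X} (h : A ⊆ B) : (emb B).comp (inc h) = emb A := rfl

theorem emb_inj (A : Set X) : Function.Injective (push (emb A)) := by
  classical
  let ret : SC X →ₗ[ℤ] SC A := slift fun n s =>
    if h : ∀ p, s p ∈ A then spt ⟨fun p => ⟨s p, h p⟩, by fun_prop⟩ else 0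
  have : ret.comp (push (emb A)) = LinearMap.id := by
    refine sc_ext fun n s => ?_
    simp only [LinearMap.comp_apply, push_spt, ret, slift_spt, LinearMap.id_apply]
    rw [dif_pos (show ∀ p, ((emb A).comp s) p ∈ A from fun p => (s p).2)]
    rfl
  exact Function.LeftInverse.injective (g := ret) fun c => LinearMap.congr_fun this c

theorem emb_mem (A : Set X) (c : SC A) : push (emb A) c ∈ Ch A :=
  push_mem _ (fun x => x.2) c

theorem emb_surj {A : Set X} {c : SC X} (hc : c ∈ Ch A) : ∃ c', push (emb A) c' = c := by
  have := Ch_mem (A := A) LinearMap.id (LinearMap.range (push (emb A))) (fun n s hs =>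
    ⟨spt ⟨fun p => ⟨s p, hs p⟩, by fun_prop⟩, by simp only [push_spt]; rfl⟩) hc
  exact this

theorem emb_cycle {A : Set X} {c : SC A} (h : sb (push (emb A) c) = 0) : sb c = 0 := by
  rw [← push_sb] at h
  exact emb_inj A (by rw [h, map_zero])

theorem TF_iff (A : Set X) : TFsub sb (Ch A) ↔ TFX A := by
  rw [TFX_iff]
  constructor
  · rintro h z hz c hc ⟨w, hw⟩
    obtain ⟨u, hu, e⟩ := h (push (emb A) z) (emb_mem A z) (by rw [← push_sb, hz, map_zero]) c hc
      ⟨push (emb A) w, emb_mem A w, by rw [← push_sb, ← hw, map_smul]⟩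
    obtain ⟨u, rfl⟩ := emb_surj hu
    exact ⟨u, emb_inj A (by rw [e, push_sb])⟩
  · rintro h z hz dz c hc ⟨w, hw, e⟩
    obtain ⟨z, rfl⟩ := emb_surj hz
    obtain ⟨w, rfl⟩ := emb_surj hw
    obtain ⟨u, hu⟩ := h z (emb_cycle dz) c hc ⟨w, emb_inj A (by rw [map_smul, e, push_sb])⟩
    exact ⟨push (emb A) u, emb_mem A u, by rw [hu, push_sb]⟩

theorem dominate (hY : TFX Y) (f : C(X, Y)) (g : C(Y, X))
    (h : (g.comp f).Homotopic (ContinuousMap.id X)) : TFX X := by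
  rw [TFX_iff] at *
  rintro z hz c hc ⟨w, hw⟩
  obtain ⟨u, hu⟩ := hY (push f z) (by rw [← push_sb, hz, map_zero]) c hc
    ⟨push f w, by rw [← push_sb, ← hw, map_smul]⟩
  obtain ⟨v, hv⟩ := homotopic_push h hz
  rw [push_id, ← push_push, hu, push_sb] at hv
  exact ⟨push g u - v, by rw [map_sub, ← hv]; abel⟩

theorem seg_homotopic {F : Type} [AddCommGroup F] [Module ℝ F] [TopologicalSpace F]
    [IsTopologicalAddGroup F] [ContinuousSMul ℝ F] {B : Set F} (f g : C(T, B))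
    (h : ∀ x, ∀ t : ℝ, 0 ≤ t → t ≤ 1 → (1 - t) • (f x : F) + t • (g x : F) ∈ B) :
    f.Homotopic g := by
  refine ⟨⟨⟨fun p => ⟨(1 - (p.1 : ℝ)) • (f p.2 : F) + (p.1 : ℝ) • (g p.2 : F),
    h p.2 p.1 p.1.2.1 p.1.2.2⟩, by fun_prop⟩, ?_, ?_⟩⟩
  · intro x; apply Subtype.ext; simp
  · intro x; apply Subtype.ext; simp

theorem mv_one {A B I U : Set X} (hA : IsOpen A) (hB : IsOpen B) (hI : A ∩ B = I) (hU : A ∪ B = U)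
    (tI : TFX I) (tU : TFX U) (s : C(U, A)) (hAU : A ⊆ U)
    (hs : ((inc hAU).comp s).Homotopic (ContinuousMap.id U)) : TFX A := by
  subst hI hU
  rw [← TF_iff] at *
  rw [Ch_inter] at tI
  refine alg_one sb_sb (Ch_mono Set.subset_union_left) (Ch_mono Set.subset_union_right)
    (fun _ => sb_mem) (fun _ => sb_mem) (small_sub hA hB) tI tU ?_
  intro e he de
  obtain ⟨e, rfl⟩ := emb_surj he
  have de := emb_cycle de
  obtain ⟨w, hw⟩ := homotopic_push hs de
  refine ⟨push (emb A) (push s e), emb_mem _ _, ?_, push (emb _) (-w), emb_mem _ _, ?_⟩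
  · rw [← push_sb, ← push_sb, de, map_zero, map_zero]
  · rw [← push_sb, map_neg, ← hw, push_id, map_neg, map_sub, push_push, push_push,
      ← ContinuousMap.comp_assoc, emb_comp_inc]
    abel

theorem mv_two {A B I U : Set X} (hA : IsOpen A) (hB : IsOpen B) (hI : A ∩ B = I) (hU : A ∪ B = U)
    (tI : TFX I) (hIB : I ⊆ B) (q : C(B, I))
    (hq : ((inc hIB).comp q).Homotopic (ContinuousMap.id B))
    (tY : TFX Y) (hAU : A ⊆ U) (r : C(U, Y)) (s : C(Y, A))
    (hs : ((s.comp r).comp (inc hAU)).Homotopic (ContinuousMap.id A)) : TFX U := by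
  subst hI hU
  rw [← TF_iff] at *
  rw [Ch_inter] at tI
  refine alg_two sb_sb (Ch_mono Set.subset_union_left) (Ch_mono Set.subset_union_right)
    (fun _ => sb_mem) (fun _ => sb_mem) (small_sub hA hB) tI ?_ ?_
  · intro e he de
    obtain ⟨e, rfl⟩ := emb_surj he
    have de := emb_cycle de
    obtain ⟨w, hw⟩ := homotopic_push hq de
    refine ⟨push (emb _) (push q e), ?_, ?_, push (emb _) (-w), emb_mem _ _, ?_⟩
    · rw [← Ch_inter]; exact emb_mem _ _
    · rw [← push_sb, ← push_sb, de, map_zero, map_zero]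
    · rw [← push_sb, map_neg, ← hw, push_id, map_neg, map_sub, push_push, push_push,
        ← ContinuousMap.comp_assoc, emb_comp_inc]
      abel
  · rintro a ha da c hc ⟨w, hw, e⟩
    obtain ⟨a, rfl⟩ := emb_surj ha
    obtain ⟨w, rfl⟩ := emb_surj hw
    have da := emb_cycle da
    have e' : c • push (inc hAU) a = sb w := emb_inj _ (by
      rw [map_smul, push_push, emb_comp_inc, e, push_sb])
    obtain ⟨u, hu⟩ := TFX_iff.1 tY (push r (push (inc hAU) a))
      (by rw [← push_sb, ← push_sb, da, map_zero, map_zero]) c hc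
      ⟨push r w, by rw [← push_sb, ← e', map_smul]⟩
    obtain ⟨v, hv⟩ := homotopic_push hs da
    rw [push_id, ← push_push, ← push_push, hu, push_sb] at hv
    refine ⟨push (emb A) (push s u - v), emb_mem _ _, ?_⟩
    rw [← push_sb, map_sub, ← hv]
    congr 1
    abel

theorem Dl_pos {n : ℕ} (p : Dl n) : n ≠ 0 := by
  rintro rfl
  have := p.2.2
  simp at this

theorem TFX_empty [IsEmpty X] : TFX X := by
  have h0 : (sb : SC X →ₗ[ℤ] SC X) = 0 := by
    refine sc_ext fun n s => ?_
    cases n with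
    | zero => simp [sb_spt_zero]
    | succ n => exact isEmptyElim (s (vtx (n + 1) 0))
  rw [TFX_iff]
  rintro z - c hc ⟨w, hw⟩
  rw [h0] at hw
  refine ⟨0, ?_⟩
  rw [map_zero]
  simpa [hc] using hw

theorem Ch_empty_bounds {A : Set X} (hA : A.Nonempty) {q : SC X} (hq : q ∈ Ch (∅ : Set X)) :
    ∃ w ∈ Ch A, q = sb w := by
  obtain ⟨a, ha⟩ := hA
  have := Ch_mem (A := ∅) LinearMap.id ((Ch A).map sb) (fun n s hs => ?_) hq
  · obtain ⟨w, hw, e⟩ := this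
    exact ⟨w, hw, e.symm⟩
  · cases n with
    | succ n => exact (hs (vtx (n + 1) 0)).elim
    | zero =>
      refine ⟨spt (n := 1) (ContinuousMap.const _ a), spt_mem fun _ => ha, ?_⟩
      rw [sb_spt_succ (n := 0), Fin.sum_univ_succ, Fin.sum_univ_zero, Fin.val_zero, pow_zero,
        one_smul, add_zero, LinearMap.id_apply]
      congr 1
      ext p
      exact (Dl_pos p rfl).elim

theorem mv_three {A B : Set X} (hA : IsOpen A) (hB : IsOpen B) (hI : A ∩ B = ∅)
    (tA : TFX A) (tB : TFX B) : TFX ↥(A ∪ B) := by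
  rcases A.eq_empty_or_nonempty with rfl | nA
  · rwa [Set.empty_union]
  rcases B.eq_empty_or_nonempty with rfl | nB
  · rwa [Set.union_empty]
  rw [← TF_iff] at *
  have tI : TFsub sb (Ch (∅ : Set X)) := (TF_iff _).2 TFX_empty
  refine alg_three sb_sb (Ch_mono Set.subset_union_left) (Ch_mono Set.subset_union_right)
    (fun _ => sb_mem) (fun _ => sb_mem) (small_sub hA hB) ?_ tA tB ?_ ?_
  · rwa [← Ch_inter, hI]
  · intro q hq _
    rw [← Ch_inter, hI] at hq
    exact Ch_empty_bounds nA hq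
  · intro q hq _
    rw [← Ch_inter, hI] at hq
    exact Ch_empty_bounds nB hq

theorem TFX_iUnion {α : Type} (S : Finset α) (V : α → Set X) (hV : ∀ a ∈ S, IsOpen (V a))
    (hd : ∀ a ∈ S, ∀ b ∈ S, ∀ x, x ∈ V a → x ∈ V b → a = b) (ht : ∀ a ∈ S, TFX (V a)) :
    TFX ↥(⋃ a ∈ S, V a) := by
  classical
  induction S using Finset.induction_on with
  | empty =>
    have : IsEmpty ↥(⋃ a ∈ (∅ : Finset α), V a) := by simp
    exact TFX_empty
  | insert a S ha ih =>
    rw [Finset.set_biUnion_insert]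
    refine mv_three (hV a (Finset.mem_insert_self _ _))
      (isOpen_biUnion fun b hb => hV b (Finset.mem_insert_of_mem hb)) ?_
      (ht a (Finset.mem_insert_self _ _)) (ih (fun b hb => hV b (Finset.mem_insert_of_mem hb))
        (fun b hb c hc => hd b (Finset.mem_insert_of_mem hb) c (Finset.mem_insert_of_mem hc))
        (fun b hb => ht b (Finset.mem_insert_of_mem hb)))
    rw [Set.eq_empty_iff_forall_notMem]
    rintro x ⟨h1, h2⟩
    simp only [Set.mem_iUnion] at h2
    obtain ⟨b, hb, h2⟩ := h2
    have := hd a (Finset.mem_insert_self _ _) b (Finset.mem_insert_of_mem hb) x h1 h2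
    subst this
    exact ha hb

theorem TFX_punit : TFX PUnit := TFX_iff.2 fun _ hz _ _ _ => punit_acyclic hz

theorem TFX_univ {F : Type} [AddCommGroup F] [Module ℝ F] [TopologicalSpace F]
    [IsTopologicalAddGroup F] [ContinuousSMul ℝ F] : TFX (Set.univ : Set F) :=
  dominate TFX_punit (ContinuousMap.const _ PUnit.unit) (ContinuousMap.const _ ⟨0, trivial⟩)
    (seg_homotopic _ _ fun _ _ _ _ => trivial)

end
end KEq


namespace KEq

section
variable {ι : Type} [Fintype ι] [DecidableEq ι]

theorem seg_apply (u v : ι → ℝ) (t : ℝ) (i : ι) :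
    ((1 - t) • u + t • v) i = (1 - t) * u i + t * v i := by simp

/-! ### Removing a linear subspace from a product -/

/-- Some coordinate in `S` is nonzero. -/
def Sph (S : Finset ι) : Set (ι → ℝ) := {x | ∃ s ∈ S, x s ≠ 0}

/-- `Y` does not constrain the coordinates in `S`. -/
def Indep (S : Finset ι) (Y : Set (ι → ℝ)) : Prop :=
  ∀ x y : ι → ℝ, (∀ i, i ∉ S → x i = y i) → x ∈ Y → y ∈ Y

theorem isOpen_Sph (S : Finset ι) : IsOpen (Sph S) := by
  have : Sph S = ⋃ s ∈ S, {x : ι → ℝ | x s ≠ 0} := by ext x; simp [Sph]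
  rw [this]
  exact isOpen_biUnion fun s _ => isOpen_ne_fun (continuous_apply s) continuous_const

theorem half_TFX (a : ι) {Y : Set (ι → ℝ)} (hi : Indep {a} Y) (tY : TFX Y) {ε : ℝ}
    (hε : ε * ε = 1) : TFX ↥(Y ∩ {x | 0 < ε * x a}) := by
  have hu : ∀ x ∈ Y, ∀ c : ℝ, Function.update x a c ∈ Y := fun x hx c =>
    hi x _ (fun i h => by
      rw [Function.update_of_ne (by simpa using h)]) hx
  refine dominate tY (inc Set.inter_subset_left)
    ⟨fun x => ⟨Function.update x.1 a ε, hu x.1 x.2 ε, by simp [hε]⟩, by fun_prop⟩ ?_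
  refine seg_homotopic _ _ fun x t h0 h1 => ⟨?_, ?_⟩
  · refine hi x.1 _ (fun i h => ?_) x.2.1
    have h : i ≠ a := by simpa using h
    rw [seg_apply]
    change _ = (1 - t) * Function.update x.1 a ε i + t * x.1 i
    rw [Function.update_of_ne h]; ring
  · change 0 < ε * _
    rw [seg_apply]
    change 0 < ε * ((1 - t) * Function.update x.1 a ε a + t * x.1 a)
    rw [Function.update_self]
    have h2 : 0 < ε * x.1 a := x.2.2
    rw [show ε * ((1 - t) * ε + t * x.1 a) = (1 - t) * (ε * ε) + t * (ε * x.1 a) by ring, hε]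
    rcases eq_or_lt_of_le h0 with rfl | h0
    · simp
    · nlinarith [mul_pos h0 h2]

/-- Set the coordinate `a` to `α` and the coordinates in `S` to `β`. -/
def stc (a : ι) (S : Finset ι) (α β : ℝ) (x : ι → ℝ) : ι → ℝ :=
  fun i => if i = a then α else if i ∈ S then β else x i

theorem continuous_stc (a : ι) (S : Finset ι) (α β : ℝ) : Continuous (stc a S α β) := by
  refine continuous_pi fun i => ?_
  unfold stc
  split_ifs <;> fun_prop

theorem sphere_TFX (S : Finset ι) (hS : S.Nonempty) {Y : Set (ι → ℝ)} (hY : IsOpen Y)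
    (hi : Indep S Y) (tY : TFX Y) : TFX ↥(Y ∩ Sph S) := by
  induction hS using Finset.Nonempty.cons_induction with
  | singleton a =>
    have : Y ∩ Sph {a} = (Y ∩ {x | 0 < (1 : ℝ) * x a}) ∪ (Y ∩ {x | 0 < (-1 : ℝ) * x a}) := by
      rw [← Set.inter_union_distrib_left]
      congr 1
      ext x
      simp only [Sph, Finset.mem_singleton, exists_eq_left, Set.mem_ofPred_eq, Set.mem_union,
        ne_iff_lt_or_gt]
      constructor
      · rintro (h | h)
        · right; linarith
        · left; linarith
      · rintro (h | h)
        · right; linarith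
        · left; linarith
    rw [this]
    refine mv_three ?_ ?_ ?_ (half_TFX a hi tY (by norm_num)) (half_TFX a hi tY (by norm_num))
    · exact hY.inter (isOpen_lt (by fun_prop) (by fun_prop))
    · exact hY.inter (isOpen_lt (by fun_prop) (by fun_prop))
    · rw [Set.eq_empty_iff_forall_notMem]
      rintro x ⟨⟨-, h1⟩, -, h2⟩
      simp only [Set.mem_ofPred_eq] at h1 h2
      linarith
  | cons a S ha hS ih =>
    rw [Finset.cons_eq_insert] at *
    have hst : ∀ α β, ∀ x ∈ Y, stc a S α β x ∈ Y := fun α β x hx => hi x _ (fun i h => by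
      simp only [Finset.mem_insert, not_or] at h
      simp [stc, h.1, h.2]) hx
    let D : ℝ → Set (ι → ℝ) := fun ε => Y ∩ {x | 0 < ε * x a ∨ x ∈ Sph S}
    have hD : ∀ ε, IsOpen (D ε) := by
      intro ε
      have h1 : IsOpen {x : ι → ℝ | 0 < ε * x a} := isOpen_lt (by fun_prop) (by fun_prop)
      exact hY.inter (h1.union (isOpen_Sph S))
    have key : ∀ ε : ℝ, ε * ε = 1 → ∀ x ∈ D ε, ∀ t : ℝ, 0 ≤ t → t ≤ 1 →
        (1 - t) • stc a S ε 0 x + t • x ∈ D ε := by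
      rintro ε hε x ⟨hx, h⟩ t h0 h1
      refine ⟨hi x _ (fun i h => ?_) hx, ?_⟩
      · simp only [Finset.mem_insert, not_or] at h
        rw [seg_apply]
        simp only [stc, h.1, h.2, if_false]; ring
      · rcases h with h | ⟨s, hs, h⟩
        · left
          rw [seg_apply]
          simp only [stc, if_true]
          rw [show ε * ((1 - t) * ε + t * x a) = (1 - t) * (ε * ε) + t * (ε * x a) by ring, hε]
          rcases eq_or_lt_of_le h0 with rfl | h0
          · simp
          · nlinarith [mul_pos h0 h]
        · rcases eq_or_lt_of_le h0 with rfl | h0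
          · left
            rw [seg_apply]
            simp [stc, hε]
          · right
            refine ⟨s, hs, ?_⟩
            rw [seg_apply]
            have : s ≠ a := by rintro rfl; exact ha hs
            simp only [stc, this, hs, if_false, if_true]
            simpa using ⟨h0.ne', h⟩
    have hI : D 1 ∩ D (-1) = Y ∩ Sph S := by
      ext x
      simp only [D, Set.mem_inter_iff, Set.mem_ofPred_eq]
      constructor
      · rintro ⟨⟨h1, h2⟩, -, h3⟩
        refine ⟨h1, ?_⟩
        rcases h2 with h2 | h2
        · rcases h3 with h3 | h3
          · linarith
          · exact h3
        · exact h2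
      · rintro ⟨h1, h2⟩
        exact ⟨⟨h1, Or.inr h2⟩, h1, Or.inr h2⟩
    have hU : D 1 ∪ D (-1) = Y ∩ Sph (insert a S) := by
      rw [← Set.inter_union_distrib_left]
      congr 1
      ext x
      simp only [Set.mem_union, Set.mem_ofPred_eq, Sph, Finset.mem_insert]
      constructor
      · rintro ((h | ⟨s, hs, h⟩) | (h | ⟨s, hs, h⟩))
        · exact ⟨a, Or.inl rfl, by rintro h2; simp [h2] at h⟩
        · exact ⟨s, Or.inr hs, h⟩
        · exact ⟨a, Or.inl rfl, by rintro h2; simp [h2] at h⟩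
        · exact ⟨s, Or.inr hs, h⟩
      · rintro ⟨s, rfl | hs, h⟩
        · rcases lt_or_gt_of_ne h with h | h
          · right; left; linarith
          · left; left; linarith
        · exact Or.inl (Or.inr ⟨s, hs, h⟩)
    have tI : TFX ↥(Y ∩ Sph S) := ih (fun x y h => hi x y fun i hh => h i fun h3 =>
      hh (Finset.mem_insert_of_mem h3))
    have hq : ∀ x ∈ Y, stc a S 0 1 x ∈ Y ∩ Sph S := fun x hx => ⟨hst _ _ x hx, by
      obtain ⟨s, hs⟩ := hS
      refine ⟨s, hs, ?_⟩
      have : s ≠ a := by rintro rfl; exact ha hs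
      simp [stc, this, hs]⟩
    have hm : ∀ ε : ℝ, ε * ε = 1 → ∀ x ∈ Y, stc a S ε 0 x ∈ D ε := fun ε hε x hx =>
      ⟨hst _ _ x hx, Or.inl (by simp [stc, hε])⟩
    have c1 := continuous_stc a S 0 1
    have c2 := continuous_stc a S (-1) 0
    have c3 := continuous_stc a S 1 0
    refine mv_two (hD 1) (hD (-1)) hI hU tI (hI ▸ Set.inter_subset_right)
      ⟨fun x => ⟨stc a S 0 1 x.1, hq x.1 x.2.1⟩, by fun_prop⟩ ?_ tY (hU ▸ Set.subset_union_left)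
      (inc Set.inter_subset_left) ⟨fun x => ⟨stc a S 1 0 x.1, hm 1 (by norm_num) x.1 x.2⟩,
        by fun_prop⟩ ?_
    · let m : C(D (-1), D (-1)) := ⟨fun x => ⟨stc a S (-1) 0 x.1, hm (-1) (by norm_num) x.1 x.2.1⟩,
        by fun_prop⟩
      refine ContinuousMap.Homotopic.trans (g := m) (seg_homotopic _ _ fun x t h0 h1 => ?_)
        (seg_homotopic _ _ fun x t h0 h1 => key (-1) (by norm_num) x.1 x.2 t h0 h1)
      change (1 - t) • stc a S 0 1 x.1 + t • stc a S (-1) 0 x.1 ∈ D (-1)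
      refine ⟨hi x.1 _ (fun i h => ?_) x.2.1, ?_⟩
      · simp only [Finset.mem_insert, not_or] at h
        rw [seg_apply]
        simp only [stc, h.1, h.2, if_false]; ring
      · rcases eq_or_lt_of_le h0 with rfl | h0
        · right
          obtain ⟨s, hs⟩ := hS
          refine ⟨s, hs, ?_⟩
          have : s ≠ a := by rintro rfl; exact ha hs
          rw [seg_apply]
          simp [stc, this, hs]
        · left
          rw [seg_apply]
          simp [stc, h0]
    · exact seg_homotopic _ _ fun x t h0 h1 => key 1 (by norm_num) x.1 x.2 t h0 h1

end
end KEq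


namespace KEq

section
variable {ι : Type} [Fintype ι] [DecidableEq ι]

/-! ### Coloured configuration spaces -/

/-- `S` is monochromatic and all its coordinates coincide. -/
def Bad {C : Type} (κ : ι → C) (x : ι → ℝ) (S : Finset ι) : Prop :=
  ∀ i ∈ S, ∀ j ∈ S, κ i = κ j ∧ x i = x j

/-- Configurations of the points in `P` without bad `k`-subsets. -/
def Conf {C : Type} (k : ℕ) (P : Finset ι) (κ : ι → C) : Set (ι → ℝ) :=
  {x | ∀ S ⊆ P, S.card = k → ¬ Bad κ x S}

theorem isOpen_not_bad {C : Type} (κ : ι → C) (S : Finset ι) :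
    IsOpen {x : ι → ℝ | ¬ Bad κ x S} := by
  have : {x : ι → ℝ | ¬ Bad κ x S} =
      ⋃ i ∈ S, ⋃ j ∈ S, ({x : ι → ℝ | ¬ κ i = κ j} ∪ {x : ι → ℝ | x i ≠ x j}) := by
    ext x
    simp only [Bad, not_forall, Set.mem_ofPred_eq, Set.mem_iUnion, Set.mem_union, exists_prop,
      not_and_or]
  rw [this]
  refine isOpen_biUnion fun i _ => isOpen_biUnion fun j _ => IsOpen.union isOpen_const ?_
  exact isOpen_ne_fun (continuous_apply i) (continuous_apply j)

theorem isOpen_Conf {C : Type} (k : ℕ) (P : Finset ι) (κ : ι → C) : IsOpen (Conf k P κ) := by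
  have : Conf k P κ = ⋂ S ∈ P.powersetCard k, {x : ι → ℝ | ¬ Bad κ x S} := by
    ext x
    simp only [Conf, Set.mem_ofPred_eq, Set.mem_iInter, Finset.mem_powersetCard, and_imp]
  rw [this]
  exact isOpen_biInter_finset fun S _ => isOpen_not_bad κ S

theorem Conf_mono {C : Type} (k : ℕ) {P Q : Finset ι} (h : P ⊆ Q) (κ : ι → C) :
    Conf k Q κ ⊆ Conf k P κ := fun _ hx S hS => hx S (hS.trans h)

theorem Conf_congr {C : Type} {k : ℕ} {P : Finset ι} {κ : ι → C} {x y : ι → ℝ}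
    (h : ∀ i ∈ P, x i = y i) (hx : x ∈ Conf k P κ) : y ∈ Conf k P κ := by
  intro S hS hk hb
  refine hx S hS hk fun i hi j hj => ⟨(hb i hi j hj).1, ?_⟩
  rw [h i (hS hi), h j (hS hj)]
  exact (hb i hi j hj).2

/-- The sign attached to a set. -/
def sg (L : Finset ι) (j : ι) : ℝ := if j ∈ L then -1 else 1

theorem sg_sq (L : Finset ι) (j : ι) : sg L j * sg L j = 1 := by
  unfold sg; split_ifs <;> norm_num

/-- The size of the cluster `S` around `p`. -/
def nS (S : Finset ι) (p : ι) (x : ι → ℝ) : ℝ := ∑ s ∈ S, |x s - x p|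

theorem nS_nonneg (S : Finset ι) (p : ι) (x : ι → ℝ) : 0 ≤ nS S p x :=
  Finset.sum_nonneg fun _ _ => abs_nonneg _

theorem le_nS {S : Finset ι} {s : ι} (hs : s ∈ S) (p : ι) (x : ι → ℝ) : |x s - x p| ≤ nS S p x :=
  Finset.single_le_sum (f := fun s => |x s - x p|) (fun _ _ => abs_nonneg _) hs

theorem continuous_nS (S : Finset ι) (p : ι) : Continuous (nS S p) := by
  unfold nS
  fun_prop

/-- The points of `J` are farther from `p` than the cluster `S`, on the side given by `L`. -/
def Vs (J S L : Finset ι) (p : ι) : Set (ι → ℝ) :=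
  {x | ∀ j ∈ J, nS S p x < sg L j * (x j - x p)}

theorem isOpen_Vs (J S L : Finset ι) (p : ι) : IsOpen (Vs J S L p) := by
  have : Vs J S L p = ⋂ j ∈ J, {x : ι → ℝ | nS S p x < sg L j * (x j - x p)} := by
    ext x; simp [Vs]
  rw [this]
  have := continuous_nS S p
  exact isOpen_biInter_finset fun j _ => isOpen_lt (by fun_prop) (by fun_prop)

/-- The forward map. -/
noncomputable def fwd (J S L : Finset ι) (p : ι) (x : ι → ℝ) : ι → ℝ := fun i =>
  if i ∈ J then Real.log (sg L i * (x i - x p) - nS S p x) else x i - x p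

/-- The backward map. -/
noncomputable def bwd (J S L : Finset ι) (p : ι) (y : ι → ℝ) : ι → ℝ := fun i =>
  if i ∈ J then sg L i * (Real.exp (y i) + ∑ s ∈ S, |y s|) else if i = p then 0 else y i

theorem continuous_bwd (J S L : Finset ι) (p : ι) : Continuous (bwd J S L p) := by
  refine continuous_pi fun i => ?_
  unfold bwd
  split_ifs <;> fun_prop

theorem continuous_fwd (J S L : Finset ι) (p : ι) :
    ContinuousOn (fwd J S L p) (Vs J S L p) := by
  refine continuousOn_pi.2 fun i => ?_
  unfold fwd
  have := continuous_nS S p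
  split_ifs with h
  · refine ContinuousOn.log (by fun_prop) fun x hx => ?_
    have := hx i h
    exact (sub_pos.2 this).ne'
  · fun_prop

theorem bwd_fwd {J S L : Finset ι} {p : ι} (hpJ : p ∉ J) (hSJ : Disjoint S J) {x : ι → ℝ}
    (hx : x ∈ Vs J S L p) (i : ι) : bwd J S L p (fwd J S L p x) i = x i - x p := by
  unfold bwd
  split_ifs with h1 h2
  · have e : ∑ s ∈ S, |fwd J S L p x s| = nS S p x := by
      refine Finset.sum_congr rfl fun s hs => ?_
      rw [fwd, if_neg (Finset.disjoint_left.1 hSJ hs)]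
    rw [e, fwd, if_pos h1, Real.exp_log (sub_pos.2 (hx i h1)), sub_add_cancel, ← mul_assoc, sg_sq,
      one_mul]
  · subst h2; simp
  · rw [fwd, if_neg h1]

theorem bwd_Vs {J S L : Finset ι} {p : ι} (hpJ : p ∉ J) (hSJ : Disjoint S J) (hpS : p ∉ S)
    (y : ι → ℝ) : bwd J S L p y ∈ Vs J S L p := by
  intro j hj
  have hp : bwd J S L p y p = 0 := by simp [bwd, hpJ]
  have e : nS S p (bwd J S L p y) = ∑ s ∈ S, |y s| := by
    refine Finset.sum_congr rfl fun s hs => ?_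
    rw [hp, sub_zero, bwd, if_neg (Finset.disjoint_left.1 hSJ hs), if_neg]
    rintro rfl; exact hpS hs
  rw [e, hp, sub_zero, bwd, if_pos hj, ← mul_assoc, sg_sq, one_mul]
  have := Real.exp_pos (y j)
  linarith

theorem sg_mul_neg {L : Finset ι} {j : ι} {r : ℝ} (hr : 0 < r) : sg L j * r < 0 ↔ j ∈ L := by
  unfold sg
  split_ifs with h
  · simp [h, hr]
  · simp [h, hr.le]

theorem sg_congr {L : Finset ι} {i j : ι} (h : (i ∈ L) = (j ∈ L)) : sg L i = sg L j := by
  simp only [sg, h]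

theorem local_TFX {C : Type} {k : ℕ} (hk : 2 ≤ k) {P : Finset ι} {κ : ι → C} {p : ι} (hp : p ∈ P)
    {J S L : Finset ι} (hSP : S ⊆ P) (hpS : p ∉ S) (hSκ : ∀ s ∈ S, κ s = κ p)
    (hSk : S.card = k - 1) (hJ : ∀ j, j ∈ J ↔ j ∈ P ∧ j ≠ p ∧ j ∉ S ∧ κ j = κ p) (hL : L ⊆ J)
    (ih : TFX ↥(Conf k (P.erase p \ S) (fun i => (κ i, i ∈ L)))) :
    TFX ↥(Conf k P κ ∩ Vs J S L p) := by
  have hpJ : p ∉ J := fun h => ((hJ p).1 h).2.1 rfl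
  have hSJ : Disjoint S J := Finset.disjoint_left.2 fun s hs h => ((hJ s).1 h).2.2.1 hs
  have hS0 : S.Nonempty := Finset.card_pos.1 (by omega)
  set R := P.erase p \ S with hR
  have hRm : ∀ i, i ∈ R ↔ i ∈ P ∧ i ≠ p ∧ i ∉ S := by
    intro i; simp [hR]; tauto
  have tQ : TFX ↥(Conf k R (fun i => (κ i, i ∈ L)) ∩ Sph S) := by
    refine sphere_TFX S hS0 (isOpen_Conf _ _ _) (fun x y h hx => Conf_congr (fun i hi => ?_) hx) ih
    exact h i ((hRm i).1 hi).2.2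
  have hf : ∀ x ∈ Conf k P κ ∩ Vs J S L p,
      fwd J S L p x ∈ Conf k R (fun i => (κ i, i ∈ L)) ∩ Sph S := by
    rintro x ⟨hx, hV⟩
    constructor
    · intro T hT hTk hb
      refine hx T (fun i hi => ((hRm i).1 (hT hi)).1) hTk fun i hi j hj => ?_
      obtain ⟨h1, h2⟩ := hb i hi j hj
      simp only [Prod.mk.injEq] at h1
      refine ⟨h1.1, ?_⟩
      have hi' := (hRm i).1 (hT hi)
      have hj' := (hRm j).1 (hT hj)
      have hiff : i ∈ J ↔ j ∈ J := by
        rw [hJ, hJ, h1.1]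
        tauto
      unfold fwd at h2
      by_cases hiJ : i ∈ J
      · have hjJ := hiff.1 hiJ
        rw [if_pos hiJ, if_pos hjJ] at h2
        have h3 := Real.log_injOn_pos (sub_pos.2 (hV i hiJ)) (sub_pos.2 (hV j hjJ)) h2
        rw [sg_congr h1.2, sub_left_inj] at h3
        have h4 := congrArg (fun r => sg L j * r) h3
        simp only [← mul_assoc, sg_sq, one_mul] at h4
        linarith
      · have hjJ := fun h => hiJ (hiff.2 h)
        rw [if_neg hiJ, if_neg hjJ] at h2
        linarith
    · by_contra hcon
      have h0 : ∀ s ∈ S, x s = x p := by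
        intro s hs
        by_contra hne
        refine hcon ⟨s, hs, ?_⟩
        rw [fwd, if_neg (Finset.disjoint_left.1 hSJ hs)]
        exact sub_ne_zero.2 hne
      have h1 : ∀ s ∈ insert p S, κ s = κ p ∧ x s = x p := by
        intro s hs
        rcases Finset.mem_insert.1 hs with rfl | hs
        · exact ⟨rfl, rfl⟩
        · exact ⟨hSκ s hs, h0 s hs⟩
      refine hx (insert p S) (Finset.insert_subset hp hSP) ?_ fun i hi j hj => ?_
      · rw [Finset.card_insert_of_notMem hpS]; omega
      · rw [(h1 i hi).1, (h1 i hi).2, (h1 j hj).1, (h1 j hj).2]; exact ⟨rfl, rfl⟩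
  have hg : ∀ y ∈ Conf k R (fun i => (κ i, i ∈ L)) ∩ Sph S,
      bwd J S L p y ∈ Conf k P κ ∩ Vs J S L p := by
    rintro y ⟨hy, s0, hs0, hys0⟩
    refine ⟨?_, bwd_Vs hpJ hSJ hpS y⟩
    intro T hT hTk hb
    have hpos : ∀ j, 0 < Real.exp (y j) + ∑ s ∈ S, |y s| := fun j =>
      add_pos_of_pos_of_nonneg (Real.exp_pos _) (Finset.sum_nonneg fun _ _ => abs_nonneg _)
    have vJ : ∀ j ∈ J, bwd J S L p y j = sg L j * (Real.exp (y j) + ∑ s ∈ S, |y s|) :=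
      fun j hj => by rw [bwd, if_pos hj]
    have vp : bwd J S L p y p = 0 := by simp [bwd, hpJ]
    have vo : ∀ j, j ∉ J → j ≠ p → bwd J S L p y j = y j := fun j h1 h2 => by
      rw [bwd, if_neg h1, if_neg h2]
    have absJ : ∀ j ∈ J, ∑ s ∈ S, |y s| < |bwd J S L p y j| := by
      intro j hj
      have h1 : |sg L j| = 1 := by unfold sg; split_ifs <;> simp
      rw [vJ j hj, abs_mul, h1, one_mul, abs_of_pos (hpos j)]
      have := Real.exp_pos (y j)
      linarith
    by_cases hex : ∃ j ∈ T, j ∈ J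
    · obtain ⟨j, hjT, hjJ⟩ := hex
      have hTJ : ∀ i ∈ T, i ∈ J := by
        intro i hi
        obtain ⟨h1, h2⟩ := hb i hi j hjT
        have habs := absJ j hjJ
        rw [← h2] at habs
        rw [hJ]
        refine ⟨hT hi, ?_, ?_, h1.trans ((hJ j).1 hjJ).2.2.2⟩
        · rintro rfl
          rw [vp, abs_zero] at habs
          exact absurd habs (not_lt.2 (Finset.sum_nonneg fun _ _ => abs_nonneg _))
        · intro hiS
          rw [vo i (Finset.disjoint_left.1 hSJ hiS) (by rintro rfl; exact hpS hiS)] at habs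
          exact absurd habs (not_lt.2
            (Finset.single_le_sum (f := fun s => |y s|) (fun _ _ => abs_nonneg _) hiS))
      refine hy T (fun i hi => ?_) hTk fun i hi j hj => ?_
      · have := (hJ i).1 (hTJ i hi)
        exact (hRm i).2 ⟨this.1, this.2.1, this.2.2.1⟩
      · obtain ⟨h1, h2⟩ := hb i hi j hj
        rw [vJ i (hTJ i hi), vJ j (hTJ j hj)] at h2
        have h3 : (i ∈ L) = (j ∈ L) := by
          refine propext ?_
          rw [← sg_mul_neg (hpos i), ← sg_mul_neg (hpos j), h2]
        refine ⟨by simp only [h1, h3], ?_⟩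
        rw [sg_congr h3] at h2
        have h4 := congrArg (fun r => sg L j * r) h2
        simp only [← mul_assoc, sg_sq, one_mul] at h4
        exact Real.exp_injective (by linarith)
    · have hTJ : ∀ i ∈ T, i ∉ J := fun i hi h => hex ⟨i, hi, h⟩
      by_cases hcol : ∃ j ∈ T, κ j = κ p
      · obtain ⟨j, hjT, hjκ⟩ := hcol
        have hTS : T ⊆ insert p S := by
          intro i hi
          by_contra hcon
          simp only [Finset.mem_insert, not_or] at hcon
          exact hTJ i hi ((hJ i).2 ⟨hT hi, hcon.1, hcon.2, (hb i hi j hjT).1.trans hjκ⟩)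
        have hTe : T = insert p S := Finset.eq_of_subset_of_card_le hTS (by
          rw [Finset.card_insert_of_notMem hpS]; omega)
        have h2 := (hb s0 (by rw [hTe]; exact Finset.mem_insert_of_mem hs0) p
          (by rw [hTe]; exact Finset.mem_insert_self _ _)).2
        rw [vp, vo s0 (Finset.disjoint_left.1 hSJ hs0) (by rintro rfl; exact hpS hs0)] at h2
        exact hys0 h2
      · have hTp : ∀ i ∈ T, i ≠ p := by rintro i hi rfl; exact hcol ⟨i, hi, rfl⟩
        have hTS : ∀ i ∈ T, i ∉ S := fun i hi h => hcol ⟨i, hi, hSκ i h⟩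
        refine hy T (fun i hi => (hRm i).2 ⟨hT hi, hTp i hi, hTS i hi⟩) hTk fun i hi j hj => ?_
        obtain ⟨h1, h2⟩ := hb i hi j hj
        rw [vo i (hTJ i hi) (hTp i hi), vo j (hTJ j hj) (hTp j hj)] at h2
        have hiL : (i ∈ L) = False := eq_false fun h => hTJ i hi (hL h)
        have hjL : (j ∈ L) = False := eq_false fun h => hTJ j hj (hL h)
        exact ⟨by simp only [h1, hiL, hjL], h2⟩
  have cf : Continuous fun x : ↥(Conf k P κ ∩ Vs J S L p) => fwd J S L p x.1 :=
    (continuous_fwd J S L p).comp_continuous continuous_subtype_val fun x => x.2.2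
  have cg := continuous_bwd J S L p
  refine dominate tQ ⟨fun x => ⟨fwd J S L p x.1, hf x.1 x.2⟩, by fun_prop⟩
    ⟨fun y => ⟨bwd J S L p y.1, hg y.1 y.2⟩, by fun_prop⟩ ?_
  refine seg_homotopic _ _ fun x t h0 h1 => ?_
  change (1 - t) • bwd J S L p (fwd J S L p x.1) + t • x.1 ∈ _
  have e : (1 - t) • bwd J S L p (fwd J S L p x.1) + t • x.1 = fun i => x.1 i - (1 - t) * x.1 p := by
    ext i
    rw [seg_apply, bwd_fwd hpJ hSJ x.2.2]
    ring
  rw [e]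
  constructor
  · intro T hT hTk hb
    refine x.2.1 T hT hTk fun i hi j hj => ⟨(hb i hi j hj).1, ?_⟩
    have := (hb i hi j hj).2
    linarith
  · intro j hj
    have := x.2.2 j hj
    have e1 : nS S p (fun i => x.1 i - (1 - t) * x.1 p) = nS S p x.1 := by
      simp [nS]
    rw [e1]
    simpa using this

end
end KEq


namespace KEq

section
variable {ι : Type} [Fintype ι] [DecidableEq ι]

theorem Conf_TFX {k : ℕ} (hk : 2 ≤ k) (N : ℕ) : ∀ (C : Type) (κ : ι → C) (P : Finset ι),
    P.card = N → TFX ↥(Conf k P κ) := by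
  classical
  induction N using Nat.strong_induction_on with
  | _ N IH =>
  intro C κ P hPN
  rcases P.eq_empty_or_nonempty with rfl | ⟨p, hp⟩
  · have : Conf k (∅ : Finset ι) κ = Set.univ := by
      rw [Set.eq_univ_iff_forall]
      intro x S hS hSk
      rw [Finset.subset_empty] at hS
      subst hS
      simp at hSk
      omega
    rw [this]
    exact TFX_univ
  set U := Conf k (P.erase p) κ with hU
  set A := Conf k P κ with hA
  have hAU : A ⊆ U := Conf_mono k (Finset.erase_subset _ _) κ
  have tU : TFX U := IH _ (by rw [← hPN]; exact Finset.card_erase_lt_of_mem hp) C κ _ rfl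
  let Jf : Finset ι → Finset ι := fun S => P.filter fun j => j ≠ p ∧ j ∉ S ∧ κ j = κ p
  have hJf : ∀ S j, j ∈ Jf S ↔ j ∈ P ∧ j ≠ p ∧ j ∉ S ∧ κ j = κ p := fun S j => by simp [Jf]
  let idx : Finset (Finset ι × Finset ι) := Finset.univ.filter fun a =>
    a.1 ⊆ P ∧ p ∉ a.1 ∧ (∀ s ∈ a.1, κ s = κ p) ∧ a.1.card = k - 1 ∧ a.2 ⊆ Jf a.1
  have hidx : ∀ a, a ∈ idx ↔ a.1 ⊆ P ∧ p ∉ a.1 ∧ (∀ s ∈ a.1, κ s = κ p) ∧ a.1.card = k - 1 ∧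
    a.2 ⊆ Jf a.1 := fun a => by simp [idx]
  let V : Finset ι × Finset ι → Set (ι → ℝ) := fun a => Vs (Jf a.1) a.1 a.2 p
  let B : Set (ι → ℝ) := ⋃ a ∈ idx, (U ∩ V a)
  have hB : IsOpen B := isOpen_biUnion fun a _ => (isOpen_Conf _ _ _).inter (isOpen_Vs _ _ _ _)
  have hAB : A ∪ B = U := by
    refine Set.Subset.antisymm (Set.union_subset hAU ?_) ?_
    · intro x hx
      simp only [B, Set.mem_iUnion] at hx
      obtain ⟨a, _, h, _⟩ := hx
      exact h
    · intro x hx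
      by_cases hxA : x ∈ A
      · exact Or.inl hxA
      right
      have : ∃ T ⊆ P, T.card = k ∧ Bad κ x T := by
        by_contra hcon
        refine hxA fun T hT hTk hb => hcon ⟨T, hT, hTk, hb⟩
      obtain ⟨T, hT, hTk, hb⟩ := this
      have hpT : p ∈ T := by
        by_contra hpT
        exact hx T (fun i hi => Finset.mem_erase.2 ⟨by rintro rfl; exact hpT hi, hT hi⟩) hTk hb
      let S := T.erase p
      have hSm : ∀ s ∈ S, s ∈ T ∧ κ s = κ p ∧ x s = x p := fun s hs =>
        ⟨Finset.mem_of_mem_erase hs, hb s (Finset.mem_of_mem_erase hs) p hpT⟩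
      let L := (Jf S).filter fun j => x j < x p
      have hi : (S, L) ∈ idx := by
        rw [hidx]
        refine ⟨fun s hs => hT (hSm s hs).1, Finset.notMem_erase _ _, fun s hs => (hSm s hs).2.1, ?_,
          Finset.filter_subset _ _⟩
        rw [Finset.card_erase_of_mem hpT, hTk]
      refine Set.mem_biUnion hi ⟨hx, ?_⟩
      intro j hj
      have h0 : nS S p x = 0 := Finset.sum_eq_zero fun s hs => by
        rw [(hSm s hs).2.2, sub_self, abs_zero]
      change nS S p x < sg L j * _
      rw [h0]
      have hj' := (hJf S j).1 hj
      have hne : x j ≠ x p := by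
        intro he
        have h1 : ∀ s ∈ insert j S, κ s = κ p ∧ x s = x p := by
          intro s hs
          rcases Finset.mem_insert.1 hs with rfl | hs
          · exact ⟨hj'.2.2.2, he⟩
          · exact (hSm s hs).2
        refine hx (insert j S) ?_ ?_ fun i hi l hl => ?_
        · intro i hi
          rcases Finset.mem_insert.1 hi with rfl | hi
          · exact Finset.mem_erase.2 ⟨hj'.2.1, hj'.1⟩
          · exact Finset.mem_erase.2 ⟨Finset.ne_of_mem_erase hi, hT (hSm i hi).1⟩
        · rw [Finset.card_insert_of_notMem hj'.2.2.1, Finset.card_erase_of_mem hpT, hTk]; omega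
        · rw [(h1 i hi).1, (h1 i hi).2, (h1 l hl).1, (h1 l hl).2]; exact ⟨rfl, rfl⟩
      rcases lt_or_gt_of_ne hne with h | h
      · have : j ∈ L := Finset.mem_filter.2 ⟨hj, h⟩
        rw [sg, if_pos this]; linarith
      · have : j ∉ L := fun hh => by
          have := (Finset.mem_filter.1 hh).2
          linarith
        rw [sg, if_neg this]; linarith
  have hI : A ∩ B = ⋃ a ∈ idx, (A ∩ V a) := by
    ext x
    simp only [B, Set.mem_inter_iff, Set.mem_iUnion, exists_prop]
    constructor
    · rintro ⟨h1, a, ha, -, h2⟩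
      exact ⟨a, ha, h1, h2⟩
    · rintro ⟨a, ha, h1, h2⟩
      exact ⟨h1, a, ha, hAU h1, h2⟩
  have tI : TFX ↥(⋃ a ∈ idx, (A ∩ V a)) := by
    refine TFX_iUnion idx _ (fun a _ => (isOpen_Conf _ _ _).inter (isOpen_Vs _ _ _ _)) ?_ ?_
    · rintro ⟨S, L⟩ ha ⟨S', L'⟩ ha' x ⟨-, hx⟩ ⟨-, hx'⟩
      rw [hidx] at ha ha'
      obtain ⟨h1, h2, h3, h4, h5⟩ := ha
      obtain ⟨h1', h2', h3', h4', h5'⟩ := ha'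
      dsimp only at h1 h2 h3 h4 h5 h1' h2' h3' h4' h5'
      have far : ∀ (S L : Finset ι) (_ : x ∈ V (S, L)) (j : ι), j ∈ Jf S →
          ∀ s ∈ S, |x s - x p| < |x j - x p| := by
        intro S L hx j hj s hs
        refine lt_of_le_of_lt (le_nS hs p x) (lt_of_lt_of_le (hx j hj) ?_)
        have e1 : |sg L j| = 1 := by unfold sg; split_ifs <;> simp
        refine (le_abs_self _).trans (le_of_eq ?_)
        rw [abs_mul]
        change |sg L j| * _ = _
        rw [e1, one_mul]
      have hSS : S = S' := by
        by_contra hne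
        have hn1 : ¬ S ⊆ S' := fun h => hne (Finset.eq_of_subset_of_card_le h (by omega))
        have hn2 : ¬ S' ⊆ S := fun h => hne (Finset.eq_of_subset_of_card_le h (by omega)).symm
        obtain ⟨s, hs, hsn⟩ := Finset.not_subset.1 hn1
        obtain ⟨s', hs', hsn'⟩ := Finset.not_subset.1 hn2
        have f1 := far S L hx s' ((hJf _ _).2 ⟨h1' hs', by rintro rfl; exact h2' hs', hsn',
          h3' s' hs'⟩) s hs
        have f2 := far S' L' hx' s ((hJf _ _).2 ⟨h1 hs, by rintro rfl; exact h2 hs, hsn,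
          h3 s hs⟩) s' hs'
        linarith
      subst hSS
      congr 1
      ext j
      have hlt : ∀ j ∈ Jf S, (j ∈ L ↔ j ∈ L') := by
        intro j hj
        have g1 := lt_of_le_of_lt (nS_nonneg _ _ _) (hx j hj)
        have g2 := lt_of_le_of_lt (nS_nonneg _ _ _) (hx' j hj)
        change 0 < sg L j * (x j - x p) at g1
        change 0 < sg L' j * (x j - x p) at g2
        unfold sg at g1 g2
        split_ifs at g1 g2 with q1 q2 q2
        · tauto
        · linarith
        · linarith
        · tauto
      exact ⟨fun h => (hlt j (h5 h)).1 h, fun h => (hlt j (h5' h)).2 h⟩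
    · rintro ⟨S, L⟩ ha
      rw [hidx] at ha
      obtain ⟨h1, h2, h3, h4, h5⟩ := ha
      refine local_TFX hk hp h1 h2 h3 h4 (hJf S) h5 (IH _ ?_ _ _ _ rfl)
      rw [← hPN]
      exact lt_of_le_of_lt (Finset.card_le_card Finset.sdiff_subset)
        (Finset.card_erase_lt_of_mem hp)
  have hup : ∀ (x : ι → ℝ) (c : ℝ), x ∈ U → Function.update x p c ∈ U := fun x c hx =>
    Conf_congr (fun i hi => by rw [Function.update_of_ne (Finset.ne_of_mem_erase hi)]) hx
  have hsec : ∀ x ∈ U, Function.update x p (1 + ∑ i, |x i|) ∈ A := by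
    intro x hx T hT hTk hb
    by_cases hpT : p ∈ T
    · have : 0 < (T.erase p).card := by rw [Finset.card_erase_of_mem hpT]; omega
      obtain ⟨i, hi⟩ := Finset.card_pos.1 this
      have h2 := (hb i (Finset.mem_of_mem_erase hi) p hpT).2
      rw [Function.update_self, Function.update_of_ne (Finset.ne_of_mem_erase hi)] at h2
      have h3 := Finset.single_le_sum (f := fun s => |x s|) (fun _ _ => abs_nonneg _)
        (Finset.mem_univ i)
      have h4 := le_abs_self (x i)
      linarith
    · exact hup x _ hx T (fun i hi => Finset.mem_erase.2 ⟨by rintro rfl; exact hpT hi, hT hi⟩) hTk hb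
  have cu : Continuous fun x : U => Function.update x.1 p (1 + ∑ i, |x.1 i|) :=
    Continuous.update continuous_subtype_val p
      ((show Continuous fun x : ι → ℝ => 1 + ∑ i, |x i| by fun_prop).comp continuous_subtype_val)
  refine mv_one (isOpen_Conf _ _ _) hB hI hAB tI tU
    ⟨fun x => ⟨Function.update x.1 p (1 + ∑ i, |x.1 i|), hsec x.1 x.2⟩, cu.subtype_mk _⟩ hAU ?_
  refine seg_homotopic _ _ fun x t h0 h1 => ?_
  refine Conf_congr (x := x.1) (fun i hi => ?_) x.2
  rw [seg_apply]
  change _ = (1 - t) * Function.update x.1 p (1 + ∑ i, |x.1 i|) i + t * x.1 i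
  rw [Function.update_of_ne (Finset.ne_of_mem_erase hi)]
  ring

end
end KEq

namespace KEq
section
open Opposite

theorem tf_of_cx (K : ChainComplex (ModuleCat.{0} ℤ) ℕ) (i : ℕ)
    (h : ∀ z : K.X i, ∀ c : ℤ, c ≠ 0 → (∃ w : K.X (i + 1), K.d (i + 1) i w = c • z) →
      ∃ w : K.X (i + 1), K.d (i + 1) i w = z) (c : ℤ) (hc : c ≠ 0) (x : K.homology i)
    (hx : c • x = 0) : x = 0 := by
  obtain ⟨y, rfl⟩ := (ModuleCat.epi_iff_surjective (K.homologyπ i)).1 inferInstance x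
  have hrel : (ComplexShape.down ℕ).prev i = i + 1 := by simp
  have ex := ShortComplex.exact_of_g_is_cokernel
    (ShortComplex.mk (K.toCycles (i + 1) i) (K.homologyπ i) (by simp))
    (K.homologyIsCokernel (i + 1) i hrel)
  rw [ShortComplex.moduleCat_exact_iff] at ex
  rw [← map_zsmul] at hx
  obtain ⟨w, hw⟩ := ex (c • y) hx
  have comp : ∀ w, K.iCycles i (K.toCycles (i + 1) i w) = K.d (i + 1) i w := fun w => by
    rw [← ConcreteCategory.comp_apply, K.toCycles_i]
  have hw : K.toCycles (i + 1) i w = c • y := hw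
  obtain ⟨u, hu⟩ := h (K.iCycles i y) c hc ⟨w, by rw [← comp, hw, map_zsmul]⟩
  have hinj := (ModuleCat.mono_iff_injective (K.iCycles i)).1 inferInstance
  have : y = K.toCycles (i + 1) i u := hinj (by rw [comp, hu])
  rw [this, ← ConcreteCategory.comp_apply]
  simp

variable (X : TopCat.{0})

/-- Simplices of the singular set. -/
abbrev Sx (i : ℕ) := (TopCat.toSSet.obj X).obj (op (SimplexCategory.mk i))

/-- Simplices as continuous maps. -/
noncomputable def Ex (i : ℕ) : Sx X i ≃ C(Dl (i + 1), X) :=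
  X.toSSetObjEquiv (op (SimplexCategory.mk i))

theorem Ex_δ (i : ℕ) (j : Fin (i + 2)) (s : Sx X (i + 1)) :
    Ex X i ((TopCat.toSSet.obj X).δ j s) = (Ex X (i + 1) s).comp (face j) := by
  have hf : ∀ q : Dl (i + 1), stdSimplex.map (S := ℝ) (SimplexCategory.δ j) q = face j q := by
    intro q
    refine stdSimplex.ext (funext fun a => ?_)
    refine (FunOnFinite.linearMap_apply_apply ℝ ℝ _ _ _).trans ?_
    change _ = scomb _ q a
    rw [scomb_apply, Finset.sum_filter]
    refine Finset.sum_congr rfl fun b _ => ?_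
    change (if j.succAbove b = a then _ else _) = _ * (stdSimplex.vertex (S := ℝ) (j.succAbove b)) a
    split_ifs with h
    · subst h; simp
    · simp [Ne.symm h]
  ext q
  change _ = Ex X (i + 1) s (face j q)
  rw [← hf]
  rfl

/-- The differential, as a linear map. -/
noncomputable def dF (i : ℕ) : (Sx X (i + 1) →₀ ℤ) →ₗ[ℤ] (Sx X i →₀ ℤ) :=
  ∑ j : Fin (i + 2), (-1 : ℤ) ^ (j : ℕ) •
    Finsupp.lmapDomain ℤ ℤ ((TopCat.toSSet.obj X).δ j : Sx X (i + 1) → Sx X i)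

theorem d_eq (i : ℕ) : (singularChainComplex X).d (i + 1) i = ModuleCat.ofHom (dF X i) := by
  have e : ModuleCat.ofHom (dF X i) = ∑ j : Fin (i + 2), (-1 : ℤ) ^ (j : ℕ) •
      (ModuleCat.ofHom (Finsupp.lmapDomain ℤ ℤ ((TopCat.toSSet.obj X).δ j :
        Sx X (i + 1) → Sx X i)) :
        ModuleCat.of ℤ (Sx X (i + 1) →₀ ℤ) ⟶ ModuleCat.of ℤ (Sx X i →₀ ℤ)) := by
    apply ModuleCat.hom_ext
    rw [ModuleCat.hom_sum]
    rfl
  refine Eq.trans ?_ e.symm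
  exact AlgebraicTopology.alternatingFaceMapComplex_obj_d _ _

theorem dF_single (i : ℕ) (s : Sx X (i + 1)) : dF X i (Finsupp.single s 1) =
    ∑ j : Fin (i + 2), (-1 : ℤ) ^ (j : ℕ) • Finsupp.single ((TopCat.toSSet.obj X).δ j s) 1 := by
  simp only [dF, LinearMap.sum_apply, LinearMap.smul_apply, Finsupp.lmapDomain_apply,
    Finsupp.mapDomain_single]

/-- Comparison of chains. -/
noncomputable def toSC (i : ℕ) : (Sx X i →₀ ℤ) →ₗ[ℤ] SC X :=
  Finsupp.linearCombination ℤ fun s => spt (Ex X i s)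

theorem toSC_single (i : ℕ) (s : Sx X i) : toSC X i (Finsupp.single s 1) = spt (Ex X i s) := by
  simp [toSC]

theorem toSC_d (i : ℕ) (z : Sx X (i + 1) →₀ ℤ) : toSC X i (dF X i z) = sb (toSC X (i + 1) z) := by
  have : (toSC X i).comp (dF X i) = sb.comp (toSC X (i + 1)) := by
    refine lin_ext fun s => ?_
    simp only [LinearMap.comp_apply, dF_single, toSC_single, map_sum, map_zsmul, sb_spt_succ, Ex_δ]
  exact LinearMap.congr_fun this z

open Classical in
/-- Projection of chains to a given degree. -/
noncomputable def ofSC (i : ℕ) : SC X →ₗ[ℤ] (Sx X i →₀ ℤ) :=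
  slift fun n s => if h : n = i + 1 then Finsupp.single ((Ex X i).symm (h ▸ s)) 1 else 0

theorem ofSC_spt (i : ℕ) (s : C(Dl (i + 1), X)) :
    ofSC X i (spt s) = Finsupp.single ((Ex X i).symm s) 1 := by
  simp [ofSC]

theorem ofSC_spt_ne (i : ℕ) {n : ℕ} (h : n ≠ i + 1) (s : C(Dl n, X)) : ofSC X i (spt s) = 0 := by
  simp [ofSC, h]

theorem ofSC_toSC (i : ℕ) (z : Sx X i →₀ ℤ) : ofSC X i (toSC X i z) = z := by
  have : (ofSC X i).comp (toSC X i) = LinearMap.id := by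
    refine lin_ext fun s => ?_
    simp only [LinearMap.comp_apply, toSC_single, ofSC_spt, Equiv.symm_apply_apply,
      LinearMap.id_apply]
  exact LinearMap.congr_fun this z

theorem ofSC_sb (i : ℕ) (w : SC X) : ofSC X i (sb w) = dF X i (ofSC X (i + 1) w) := by
  have : (ofSC X i).comp sb = (dF X i).comp (ofSC X (i + 1)) := by
    refine sc_ext fun n s => ?_
    simp only [LinearMap.comp_apply]
    by_cases h : n = i + 2
    · subst h
      rw [sb_spt_succ, ofSC_spt, dF_single, map_sum]
      refine Finset.sum_congr rfl fun j _ => ?_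
      rw [map_zsmul, ofSC_spt]
      congr 2
      rw [Equiv.symm_apply_eq, Ex_δ, Equiv.apply_symm_apply]
    · rw [ofSC_spt_ne X (i + 1) h, map_zero]
      cases n with
      | zero => rw [sb_spt_zero, map_zero]
      | succ n =>
        rw [sb_spt_succ, map_sum]
        refine Finset.sum_eq_zero fun j _ => ?_
        rw [map_zsmul, ofSC_spt_ne X i (by omega), smul_zero]
  exact LinearMap.congr_fun this w

theorem dF_tf (hX : TFX X) (i : ℕ) (z : Sx X i →₀ ℤ) (c : ℤ) (hc : c ≠ 0)
    (hw : ∃ w, dF X i w = c • z) : ∃ w, dF X i w = z := by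
  obtain ⟨w, hw⟩ := hw
  have h1 : c • toSC X i z = sb (toSC X (i + 1) w) := by rw [← toSC_d, hw, map_zsmul]
  have h2 : sb (toSC X i z) = 0 := by
    have : c • sb (toSC X i z) = 0 := by rw [← map_zsmul, h1, sb_sb]
    simpa [hc] using this
  obtain ⟨u, hu⟩ := TFX_iff.1 hX _ h2 c hc ⟨_, h1⟩
  exact ⟨ofSC X (i + 1) u, by rw [← ofSC_sb, ← hu, ofSC_toSC]⟩

theorem tf_singular (hX : TFX X) (i : ℕ) (c : ℤ) (hc : c ≠ 0) (x : singularHomology X i)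
    (hx : c • x = 0) : x = 0 := by
  refine tf_of_cx (singularChainComplex X) i ?_ c hc x hx
  rintro z c hc ⟨w, hw⟩
  rw [d_eq] at hw ⊢
  exact dF_tf X hX i z c hc ⟨w, hw⟩

end
end KEq

theorem homology_of_k_equal_complement_torsionFree (n k : ℕ) (hk : 3 ≤ k) (hkn : k ≤ n)
    (i : ℕ) :
    ∀ c : ℤ, c ≠ 0 →
      ∀ x : (singularHomology (TopCat.of (kEqualComplement n k)) i), c • x = 0 → x = 0 := by
  have e : kEqualComplement n k
      = KEq.Conf k (Finset.univ : Finset (Fin (n + 1))) (fun _ => PUnit.unit.{1}) := by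
    ext x
    simp [kEqualComplement, KEq.Conf, KEq.Bad]
  have ht : KEq.TFX ↥(kEqualComplement n k) := by
    rw [e]
    exact KEq.Conf_TFX (by omega) _ _ _ _ rfl
  exact KEq.tf_singular (TopCat.of (kEqualComplement n k)) ht i
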